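/- arXiv:1708.09683 — 10 statements merged into one kernel-verified Lean document; each statement's English description precedes it below -/
import Mathlib

section
/- Let M be a (possibly infinite) index set and let (Γ_i)_{i ∈ M} be a family of abelian groups. Then the commutator subgroup of the free product Γ_1 * Γ_2 * ... (i.e., of Monoid.CoprodI Γ) is a free group. -/
open CategoryTheory CategoryTheory.ActionCategory Monoid

section FreeFactorAction

universe u v w

variable {M : Type u} {Γ : M → Type v} [∀ i, Group (Γ i)]

/-- If a group acts freely on a set, the set admits an equivariant map to the group acting on
itself by left multiplication. -/
theorem exists_equivariant_of_free {G : Type*} {A : Type*} [Group G] [MulAction G A]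
    (free : ∀ (g : G) (a : A), g • a = a → g = 1) :
    ∃ t : A → G, ∀ (g : G) (a : A), t (g • a) = g * t a := by
  let rep : A → A := fun a => (Quotient.mk (MulAction.orbitRel G A) a).out
  have rep_smul (g : G) (a : A) : rep (g • a) = rep a :=
    congrArg Quotient.out (Quotient.sound (MulAction.mem_orbit a g))
  have rep_rel (a : A) : ∃ g : G, g • rep a = a :=
    (MulAction.orbitRel G A).symm (Quotient.exact (Quotient.out_eq _))
  choose t ht using rep_rel
  refine ⟨t, fun g a => ?_⟩
  rw [← inv_mul_eq_one]
  apply free _ (rep a)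
  have h := ht (g • a)
  rw [rep_smul] at h
  rw [mul_smul, mul_smul, ht, inv_smul_eq_iff, h]

variable {A : Type w} [MulAction (CoprodI Γ) A]

/-- The edges from `a` to `b`, labelled by nontrivial elements of a factor `Γ i`, starting at the
chosen representatives `a` (those with `t i a = 1`) of the `Γ i`-orbits. -/
def CoprodIEdge (t : ∀ i, A → Γ i) (a b : A) : Type (max u v) :=
  { e : Σ i, Γ i // t e.1 a = 1 ∧ e.2 ≠ 1 ∧ (CoprodI.of e.2 : CoprodI Γ) • a = b }

open Classical in
/-- The potential on `A` attached to a labelling of the edges: each point is labelled by the edge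
joining it to the representative of its `Γ i`-orbit. -/
noncomputable def edgePotential {X : Type*} [Group X] {t : ∀ i, A → Γ i}
    (ht : ∀ i (g : Γ i) a, t i ((CoprodI.of g : CoprodI Γ) • a) = g * t i a)
    (f : ∀ a b, CoprodIEdge t a b → X) (i : M) (b : A) : X :=
  if h : t i b = 1 then 1 else
    f ((CoprodI.of (t i b) : CoprodI Γ)⁻¹ • b) b
      ⟨⟨i, t i b⟩, by rw [← map_inv, ht, inv_mul_cancel], h, smul_inv_smul _ _⟩

theorem edgePotential_of_eq_one {X : Type*} [Group X] {t : ∀ i, A → Γ i}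
    (ht : ∀ i (g : Γ i) a, t i ((CoprodI.of g : CoprodI Γ) • a) = g * t i a)
    (f : ∀ a b, CoprodIEdge t a b → X) {i : M} {b : A} (h : t i b = 1) :
    edgePotential ht f i b = 1 :=
  dif_pos h

theorem edgePotential_target {X : Type*} [Group X] {t : ∀ i, A → Γ i}
    (ht : ∀ i (g : Γ i) a, t i ((CoprodI.of g : CoprodI Γ) • a) = g * t i a)
    (f : ∀ a b, CoprodIEdge t a b → X) {a b : A} (e : CoprodIEdge t a b) :
    edgePotential ht f e.1.1 b = f a b e := by
  obtain ⟨⟨i, g⟩, h1, hg, hb⟩ := e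
  dsimp only at h1 hg hb
  have hgb : t i b = g := by rw [← hb, ht, h1, mul_one]
  have ha : (CoprodI.of (t i b) : CoprodI Γ)⁻¹ • b = a := by
    rw [hgb, ← hb, inv_smul_smul]
  subst hgb
  subst ha
  exact dif_neg hg

/-- The homomorphism to the wreath product that is inner, with conjugator given by the potential,
on each factor. -/
noncomputable def wreathLift {X : Type*} [Group X] (φ : M → A → X) :
    CoprodI Γ →* (A → X) ⋊[mulAutArrow] CoprodI Γ :=
  CoprodI.lift fun i =>
    { toFun := fun g => ⟨fun b => φ i b * (φ i ((CoprodI.of g : CoprodI Γ)⁻¹ • b))⁻¹, CoprodI.of g⟩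
      map_one' := by
        ext <;> simp
      map_mul' := fun g h => by
        ext b
        · change _ = φ i b * (φ i ((CoprodI.of g : CoprodI Γ)⁻¹ • b))⁻¹ *
            (φ i ((CoprodI.of g : CoprodI Γ)⁻¹ • b) *
              (φ i ((CoprodI.of h : CoprodI Γ)⁻¹ • (CoprodI.of g : CoprodI Γ)⁻¹ • b))⁻¹)
          simp [mul_smul, mul_assoc]
        · simp }

theorem wreathLift_of_left {X : Type*} [Group X] (φ : M → A → X) {i : M} (g : Γ i) (b : A) :
    (wreathLift φ (CoprodI.of g)).left b =
      φ i b * (φ i ((CoprodI.of g : CoprodI Γ)⁻¹ • b))⁻¹ := by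
  simp [wreathLift]

theorem wreathLift_right {X : Type*} [Group X] (φ : M → A → X) (g : CoprodI Γ) :
    (wreathLift φ g).right = g := by
  suffices SemidirectProduct.rightHom.comp (wreathLift φ) = MonoidHom.id (CoprodI Γ) from
    DFunLike.congr_fun this g
  ext i g
  simp [wreathLift]

/-- The action groupoid of a free product acting on a set is free when each factor acts freely. -/
noncomputable abbrev coprodIActionGroupoidIsFree (t : ∀ i, A → Γ i)
    (ht : ∀ i (g : Γ i) a, t i ((CoprodI.of g : CoprodI Γ) • a) = g * t i a) :
    IsFreeGroupoid (ActionCategory (CoprodI Γ) A) where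
  quiverGenerators := ⟨fun a b => CoprodIEdge t a.back b.back⟩
  of := fun e => ⟨CoprodI.of e.1.2, e.2.2.2⟩
  unique_lift := by
    intro X _ f
    let f' : ∀ a b, CoprodIEdge t a b → X := fun a b e => @f ⟨(), a⟩ ⟨(), b⟩ e
    refine ⟨uncurry (wreathLift (edgePotential ht f')) (wreathLift_right _), ?_, ?_⟩
    · rintro ⟨⟨⟩, a : A⟩ ⟨⟨⟩, b : A⟩ e
      change (wreathLift (edgePotential ht f') (CoprodI.of e.1.2)).left b = _
      have h : (CoprodI.of e.1.2 : CoprodI Γ)⁻¹ • b = a := inv_smul_eq_iff.mpr e.2.2.2.symm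
      have ha : edgePotential ht f' e.1.1 a = 1 := edgePotential_of_eq_one ht f' e.2.1
      rw [wreathLift_of_left, h, ha, inv_one, mul_one]
      exact edgePotential_target ht f' e
    · intro E hE
      have left_mul (i : M) (g h : Γ i) (b : A) :
          (curry E (CoprodI.of (g * h))).left b = (curry E (CoprodI.of g)).left b *
            (curry E (CoprodI.of h)).left ((CoprodI.of g : CoprodI Γ)⁻¹ • b) := by
        rw [map_mul, map_mul]
        rfl
      have left_coord (i : M) (b : A) :
          (curry E (CoprodI.of (t i b))).left b = edgePotential ht f' i b := by
        by_cases h : t i b = 1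
        · rw [edgePotential_of_eq_one ht f' h, h, map_one, map_one]
          rfl
        · rw [edgePotential, dif_neg h]
          exact hE ⟨(), (CoprodI.of (t i b) : CoprodI Γ)⁻¹ • b⟩ ⟨(), b⟩
            ⟨⟨i, t i b⟩, by rw [coe_back, ← map_inv, ht, inv_mul_cancel], h, smul_inv_smul _ _⟩
      have : curry E = wreathLift (edgePotential ht f') := by
        apply CoprodI.ext_hom
        intro i
        ext g b
        · simp only [MonoidHom.comp_apply]
          rw [wreathLift_of_left, ← left_coord, ← left_coord, eq_mul_inv_iff_mul_eq, ← left_mul,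
            ← map_inv, ht, mul_inv_cancel_left]
        · exact (wreathLift_right _ _).symm
      apply Functor.hext
      · intro
        apply Unit.ext
      · refine ActionCategory.cases ?_
        intros
        exact heq_of_eq (congrFun (congrArg SemidirectProduct.left (DFunLike.congr_fun this _)) _)

/-- A subgroup of a free product is free when each factor acts freely on its cosets. -/
theorem isFreeGroup_of_coprodI_free_quotient (H : Subgroup (CoprodI Γ))
    (free : ∀ i (g : Γ i) (a : CoprodI Γ ⧸ H), (CoprodI.of g : CoprodI Γ) • a = a → g = 1) :
    IsFreeGroup H := by
  have (i : M) : ∃ t : CoprodI Γ ⧸ H → Γ i,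
      ∀ g a, t ((CoprodI.of g : CoprodI Γ) • a) = g * t a :=
    let := MulAction.compHom (CoprodI Γ ⧸ H) (CoprodI.of : Γ i →* CoprodI Γ)
    exists_equivariant_of_free (free i)
  choose t ht using this
  let free_groupoid := coprodIActionGroupoidIsFree t ht
  have connected : IsConnected (ActionCategory (CoprodI Γ) (CoprodI Γ ⧸ H)) := inferInstance
  have free_end := @IsFreeGroupoid.endIsFreeOfConnectedFree _ _ connected free_groupoid
    (objEquiv (CoprodI Γ) (CoprodI Γ ⧸ H) ((1 : CoprodI Γ) : CoprodI Γ ⧸ H))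
  exact @IsFreeGroup.ofMulEquiv _ _ free_end H _ (endMulEquivSubgroup H)

end FreeFactorAction

/-- The commutator subgroup of a free product of abelian groups is a free group. -/
theorem stmt0 {M : Type*} (Γ : M → Type*) [∀ i, CommGroup (Γ i)] :
    IsFreeGroup ↥(commutator (Monoid.CoprodI Γ)) := by
  classical
  apply isFreeGroup_of_coprodI_free_quotient
  intro i g a
  induction a using QuotientGroup.induction_on with | H x => ?_
  intro h
  have hmem : x⁻¹ * (CoprodI.of g : CoprodI Γ)⁻¹ * x ∈ commutator (CoprodI Γ) := by
    have := QuotientGroup.eq.mp h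
    simpa [mul_assoc] using this
  have hker := Abelianization.commutator_subset_ker
    (CoprodI.lift (Pi.mulSingle i (MonoidHom.id (Γ i)))) hmem
  simpa [MonoidHom.mem_ker] using hker
end

section
/- Let M be a natural number and let Γ_1, ..., Γ_M be finite abelian groups. Then the commutator subgroup of the free product Γ_1 * ... * Γ_M is a finitely generated free group, i.e., it is a free group and is finitely generated. -/
universe u v

open CategoryTheory in
/-- A group which is isomorphic to a vertex group of a connected free groupoid is free. -/
theorem IsFreeGroupoid.isFreeGroup_of_vertexEquiv {G : Type u} [Groupoid.{u} G]
    [IsFreeGroupoid G] (connected : ∀ a b : G, Nonempty (a ⟶ b)) {K : Type u} [Group K]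
    (r : G) (e : (r ⟶ r) ≃ K) (map_comp : ∀ f g : r ⟶ r, e (f ≫ g) = e g * e f) : IsFreeGroup K :=
  have : Nonempty G := ⟨r⟩
  have : IsConnected G :=
    zigzag_isConnected fun a b => Relation.ReflTransGen.single (Or.inl (connected a b))
  IsFreeGroup.ofMulEquiv (G := End r) (MulEquiv.mk' e fun f g => map_comp g f)

open CategoryTheory CategoryTheory.ActionCategory in
/-- If every factor of a free product acts freely on `A`, then the action groupoid of the free
product on `A` is free: in every orbit of every factor, pick a base point and take as generators
the arrows from the base point to the other points of the orbit. -/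
theorem Monoid.CoprodI.nonempty_isFreeGroupoid_actionCategory {ι : Type v} {Γ : ι → Type u}
    [∀ i, Group (Γ i)] {A : Type max u v} [MulAction (Monoid.CoprodI Γ) A]
    (free : ∀ (i : ι) (g : Γ i) (a : A), (Monoid.CoprodI.of g : Monoid.CoprodI Γ) • a = a → g = 1) :
    Nonempty (IsFreeGroupoid (ActionCategory (Monoid.CoprodI Γ) A)) := by
  classical
  have base : ∀ i, ∃ (r : A → A) (t : A → Γ i),
      (∀ (g : Γ i) a, r ((of g : Monoid.CoprodI Γ) • a) = r a) ∧
      ∀ a, (of (t a) : Monoid.CoprodI Γ) • r a = a := by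
    intro i
    let : MulAction (Γ i) A := MulAction.compHom A (of : Γ i →* Monoid.CoprodI Γ)
    have smul_def : ∀ (g : Γ i) (a : A), g • a = (of g : Monoid.CoprodI Γ) • a := fun _ _ => rfl
    let r : A → A := fun a => (Quotient.mk (MulAction.orbitRel (Γ i) A) a).out
    have hr : ∀ a, ∃ t : Γ i, t • r a = a := fun a =>
      MulAction.mem_orbit_iff.mp ((MulAction.orbitRel (Γ i) A).symm (Quotient.mk_out a))
    choose t ht using hr
    refine ⟨r, t, fun g a => ?_, ht⟩
    exact congrArg Quotient.out (Quotient.sound (MulAction.orbitRel_apply.mpr ⟨g, rfl⟩))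
  choose r t r_smul t_smul using base
  have r_r : ∀ i a, r i (r i a) = r i a := fun i a => by
    conv_rhs => rw [← t_smul i a, r_smul]
  have inj : ∀ i (g h : Γ i) (a : A),
      (of g : Monoid.CoprodI Γ) • a = (of h : Monoid.CoprodI Γ) • a → g = h := by
    intro i g h a H
    have := free i (h⁻¹ * g) a (by rw [map_mul, mul_smul, H, map_inv, inv_smul_smul])
    exact (inv_mul_eq_one.mp this).symm
  have t_of_base : ∀ i (g : Γ i) a, r i a = a → t i ((of g : Monoid.CoprodI Γ) • a) = g := by
    intro i g a ha
    refine inj i _ _ a ?_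
    have := t_smul i ((of g : Monoid.CoprodI Γ) • a)
    rwa [r_smul, ha] at this
  refine ⟨{
    quiverGenerators := ⟨fun a b => { p : Σ i, Γ i //
      p.2 ≠ 1 ∧ r p.1 a.back = a.back ∧ (of p.2 : Monoid.CoprodI Γ) • a.back = b.back }⟩
    of := fun e => ⟨of e.1.2, e.2.2.2⟩
    unique_lift := ?_ }⟩
  intro X _ f
  let h : ∀ i, A → X := fun i a =>
    if ht : t i a = 1 then 1 else
      @f ⟨(), r i a⟩ ⟨(), a⟩ ⟨⟨i, t i a⟩, ht, r_r i a, t_smul i a⟩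
  let φ : ∀ i, Γ i →* (A → X) ⋊[mulAutArrow] (Monoid.CoprodI Γ) := fun i =>
    (MulAut.conj (SemidirectProduct.inl (h i))).toMonoidHom.comp (SemidirectProduct.inr.comp of)
  have φ_left : ∀ i (g : Γ i) b,
      (φ i g).left b = h i b * (h i ((of g : Monoid.CoprodI Γ)⁻¹ • b))⁻¹ := by
    intro i g b
    simp [φ]
    rfl
  have φ_right : ∀ i (g : Γ i), (φ i g).right = of g := by
    intro i g
    simp [φ]
  have h_base : ∀ i a, r i a = a → h i a = 1 := by
    intro i a ha
    have : t i a = 1 := by simpa using t_of_base i 1 a ha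
    exact dif_pos this
  have h_gen : ∀ i (g : Γ i) (hg : g ≠ 1) (a b : A) (ha : r i a = a)
      (hb : (of g : Monoid.CoprodI Γ) • a = b),
      h i b = @f ⟨(), a⟩ ⟨(), b⟩ ⟨⟨i, g⟩, hg, ha, hb⟩ := by
    intro i g hg a b ha hb
    have h1 : r i b = a := by rw [← hb, r_smul, ha]
    have h2 : t i b = g := by rw [← hb, t_of_base i g a ha]
    subst h1 h2
    exact dif_neg hg
  refine ⟨uncurry (lift φ) ?_, ?_, ?_⟩
  · suffices SemidirectProduct.rightHom.comp (lift φ) = MonoidHom.id _ by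
      exact DFunLike.ext_iff.mp this
    refine ext_hom _ _ fun i => ?_
    ext g
    simpa using φ_right i g
  · rintro ⟨⟨⟩, a : A⟩ ⟨⟨⟩, b : A⟩ ⟨⟨i, g⟩, hg, ha, hb⟩
    change r i a = a at ha
    change (of g : Monoid.CoprodI Γ) • a = b at hb
    change (lift φ (of g)).left b = _
    rw [lift_of, φ_left, h_gen i g hg a b ha hb, inv_smul_eq_iff.mpr hb.symm, h_base i a ha,
      inv_one, mul_one]
  · intro E hE
    let arrow : ∀ (a b : A) (x : Monoid.CoprodI Γ), x • a = b →
        (objEquiv (Monoid.CoprodI Γ) A a ⟶ objEquiv (Monoid.CoprodI Γ) A b) :=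
      fun _ _ x hx => ⟨x, hx⟩
    have E_base : ∀ i (a b : A) (ha : r i a = a) (g : Γ i)
        (hb : (of g : Monoid.CoprodI Γ) • a = b),
        (E.map (arrow a b (of g) hb) : X) = h i b := by
      intro i a b ha g hb
      by_cases hg : g = 1
      · subst hg
        have hab : a = b := by simpa using hb
        subst hab
        rw [h_base i a ha]
        refine Eq.trans ?_ (E.map_id _)
        congr 1
        exact Subtype.ext (map_one _)
      · rw [h_gen i g hg a b ha hb]
        exact hE ⟨(), a⟩ ⟨(), b⟩ ⟨⟨i, g⟩, hg, ha, hb⟩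
    have curry_eq : curry E = lift φ := by
      refine ext_hom _ _ fun i => ?_
      ext g : 1
      rw [MonoidHom.comp_apply, MonoidHom.comp_apply, lift_of]
      ext b
      · rw [φ_left, eq_mul_inv_iff_mul_eq]
        set c : A := (of g : Monoid.CoprodI Γ)⁻¹ • b
        have hgc : (of g : Monoid.CoprodI Γ) • c = b := smul_inv_smul _ _
        have comp_eq : arrow (r i c) c (of (t i c)) (t_smul i c) ≫ arrow c b (of g) hgc =
            arrow (r i c) b (of (g * t i c)) (by rw [map_mul, mul_smul, t_smul, hgc]) :=
          Subtype.ext (map_mul (of : Γ i →* Monoid.CoprodI Γ) g (t i c)).symm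
        rw [← E_base i (r i c) c (r_r i c) (t i c) (t_smul i c),
          ← E_base i (r i c) b (r_r i c) (g * t i c)
            (by rw [map_mul, mul_smul, t_smul, hgc])]
        exact (E.map_comp _ _).symm.trans (congrArg E.map comp_eq)
      · exact (φ_right i g).symm
    apply Functor.hext
    · intro
      apply Unit.ext
    · refine ActionCategory.cases fun b x => ?_
      refine heq_of_eq ?_
      change (curry E x).left b = (lift φ x).left b
      rw [curry_eq]

open CategoryTheory CategoryTheory.ActionCategory in
/-- A normal subgroup of a free product which meets every factor trivially is free. -/
theorem Monoid.CoprodI.isFreeGroup_of_normal {ι : Type v} {Γ : ι → Type u} [∀ i, Group (Γ i)]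
    (N : Subgroup (Monoid.CoprodI Γ)) [N.Normal]
    (hN : ∀ (i : ι) (g : Γ i), (Monoid.CoprodI.of g : Monoid.CoprodI Γ) ∈ N → g = 1) :
    IsFreeGroup N := by
  obtain ⟨_⟩ := nonempty_isFreeGroupoid_actionCategory.{u, v} (A := Monoid.CoprodI Γ ⧸ N) (by
    intro i g a
    induction a using QuotientGroup.induction_on with
    | H x =>
      intro h
      refine hN i g ?_
      have h' : ((of g * x : Monoid.CoprodI Γ) : Monoid.CoprodI Γ ⧸ N) = x := h
      rw [QuotientGroup.mk_mul, mul_eq_right] at h'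
      exact (QuotientGroup.eq_one_iff _).mp h')
  exact IsFreeGroupoid.isFreeGroup_of_vertexEquiv
    (G := ActionCategory (Monoid.CoprodI Γ) (Monoid.CoprodI Γ ⧸ N))
    (fun a b => nonempty_subtype.mpr (MulAction.exists_smul_eq (Monoid.CoprodI Γ) a.back b.back))
    (objEquiv _ _ ((1 : Monoid.CoprodI Γ) : Monoid.CoprodI Γ ⧸ N))
    (endMulEquivSubgroup N).toEquiv fun f g => (endMulEquivSubgroup N).map_mul g f

/-- A free product of finitely many finite groups is finitely generated. -/
theorem Monoid.CoprodI.group_fg_of_finite {ι : Type*} [Finite ι] {Γ : ι → Type*}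
    [∀ i, Group (Γ i)] [∀ i, Finite (Γ i)] : Group.FG (Monoid.CoprodI Γ) :=
  Group.fg_iff_monoid_fg.mpr <| Monoid.fg_iff.mpr
    ⟨_, mclosure_iUnion_range_of, Set.finite_iUnion fun _ => Set.finite_range _⟩

/-- The abelianization of a free product of finitely many finite abelian groups is finite. -/
theorem Monoid.CoprodI.finite_abelianization {ι : Type*} [Finite ι] {Γ : ι → Type*}
    [∀ i, CommGroup (Γ i)] [∀ i, Finite (Γ i)] :
    Finite (Abelianization (Monoid.CoprodI Γ)) := by
  classical
  cases nonempty_fintype ι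
  let ψ : (∀ i, Γ i) →* Abelianization (Monoid.CoprodI Γ) :=
    MonoidHom.noncommPiCoprod (fun i => Abelianization.of.comp of)
      fun _ _ _ _ _ => Commute.all _ _
  have comp_eq : ψ.comp (lift fun i => MonoidHom.mulSingle Γ i) = Abelianization.of := by
    refine ext_hom _ _ fun i => ?_
    ext g
    simp only [MonoidHom.comp_apply, lift_of, MonoidHom.mulSingle_apply]
    exact MonoidHom.noncommPiCoprod_mulSingle _ _ _
  refine Finite.of_surjective ψ fun y => ?_
  obtain ⟨x, rfl⟩ := QuotientGroup.mk_surjective y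
  exact ⟨_, DFunLike.congr_fun comp_eq x⟩

/-- The commutator subgroup of a free product of abelian groups meets every factor trivially. -/
theorem Monoid.CoprodI.eq_one_of_mem_commutator {ι : Type*} {Γ : ι → Type*}
    [∀ i, CommGroup (Γ i)] {i : ι} {g : Γ i}
    (hg : (of g : Monoid.CoprodI Γ) ∈ commutator (Monoid.CoprodI Γ)) : g = 1 := by
  classical
  have h := Abelianization.commutator_subset_ker
    (lift (Pi.mulSingle i (MonoidHom.id (Γ i)))) hg
  rwa [MonoidHom.mem_ker, of_leftInverse i g] at h

/-- The commutator subgroup of a free product of finitely many finite abelian groups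
is a finitely generated free group. -/
theorem stmt1 (M : ℕ) (Γ : Fin M → Type*) [∀ i, CommGroup (Γ i)] [∀ i, Finite (Γ i)] :
    IsFreeGroup ↥(commutator (Monoid.CoprodI Γ)) ∧
      Group.FG ↥(commutator (Monoid.CoprodI Γ)) := by
  refine ⟨Monoid.CoprodI.isFreeGroup_of_normal _ fun _ _ =>
    Monoid.CoprodI.eq_one_of_mem_commutator, ?_⟩
  have := Monoid.CoprodI.group_fg_of_finite (Γ := Γ)
  have : Finite (Monoid.CoprodI Γ ⧸ commutator (Monoid.CoprodI Γ)) :=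
    Monoid.CoprodI.finite_abelianization
  have : (commutator (Monoid.CoprodI Γ)).FiniteIndex := Subgroup.finiteIndex_of_finite_quotient
  exact Subgroup.fg_of_index_ne_zero _
end

section
/- Let K ≥ 1 and M be natural numbers, and let Ω be the free product of M copies of the cyclic group ZMod K. If N is any subgroup of Ω contained in the commutator subgroup ⁅Ω,Ω⁆ (for example, the kernel of a quotient map Ω → Γ onto a uniform group), then N is a free group. -/
universe u

open CategoryTheory CategoryTheory.ActionCategory Monoid in
/-- If every factor `G i` acts freely on `A`, then the action groupoid of the free product of the
`G i` on `A` is free. Here `s i a` is a chosen representative of the `G i`-orbit of `a` and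
`t i a` carries it to `a`; the generators are the arrows `s i a ⟶ a` with `s i a ≠ a`. -/
@[reducible]
def IsFreeGroupoid.actionCategoryCoprodI {ι A : Type u} {G : ι → Type u} [∀ i, Group (G i)]
    [MulAction (CoprodI G) A] (s : ι → A → A) (t : ∀ i, A → G i)
    (ht : ∀ i a, (CoprodI.of (t i a) : CoprodI G) • s i a = a)
    (hs : ∀ i (g : G i) a, s i ((CoprodI.of g : CoprodI G) • a) = s i a)
    (hfree : ∀ i (g : G i) (a : A), (CoprodI.of g : CoprodI G) • a = a → g = 1) :
    IsFreeGroupoid (ActionCategory (CoprodI G) A) where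
  quiverGenerators :=
    ⟨fun a b => { i : ι // s i b.back = a.back ∧ a.back ≠ b.back }⟩
  of := fun {a b} (e : Subtype _) => ⟨CoprodI.of (t e.1 b.back), by
    have h := ht e.1 b.back
    rwa [e.2.1] at h⟩
  unique_lift := by
    classical
    intro X _ f
    let lab : ι → A → X := fun i a =>
      if h : s i a = a then 1 else @f ⟨(), s i a⟩ ⟨(), a⟩ ⟨i, rfl, h⟩
    let F' : CoprodI G →* (A → X) ⋊[mulAutArrow] CoprodI G := CoprodI.lift fun i =>
      (MulAut.conj (SemidirectProduct.inl (lab i))).toMonoidHom.comp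
        (SemidirectProduct.inr.comp CoprodI.of)
    have hF'of : ∀ i (g : G i) (b : A), (F' (CoprodI.of g)).left b =
        lab i b * (lab i ((CoprodI.of g : CoprodI G)⁻¹ • b))⁻¹ := by
      intro i g b
      simp [F']
      rfl
    have hF'right : ∀ g, (F' g).right = g := by
      suffices SemidirectProduct.rightHom.comp F' = MonoidHom.id _ from
        fun g => DFunLike.congr_fun this g
      apply CoprodI.ext_hom
      intro i
      ext g
      simp [F']
    have hss : ∀ i a, s i (s i a) = s i a := fun i a => by
      conv_rhs => rw [← ht i a, hs]
    refine ⟨uncurry F' hF'right, ?_, ?_⟩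
    · rintro ⟨⟨⟩, a : A⟩ ⟨⟨⟩, b : A⟩ ⟨i, h : s i b = a, hne : a ≠ b⟩
      subst h
      change (F' (CoprodI.of (t i b))).left b = _
      rw [hF'of, inv_smul_eq_iff.mpr (ht i b).symm]
      simp only [lab]
      rw [dif_neg hne, dif_pos (hss i b), inv_one, mul_one]
    · intro E hE
      have hE' : ∀ {a b : ActionCategory (CoprodI G) A} (p : a ⟶ b),
          (E.map p : X) = (curry E p.val).left b.back := by
        apply ActionCategory.cases
        intros
        rfl
      have hlab : ∀ i b, (curry E (CoprodI.of (t i b))).left b = lab i b := by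
        intro i b
        by_cases h : s i b = b
        · have h1 : t i b = 1 := hfree i _ b (by simpa only [h] using ht i b)
          simp only [lab]
          rw [dif_pos h, h1, map_one, map_one]
          rfl
        · simp only [lab]
          rw [dif_neg h]
          exact (hE' _).symm.trans (hE ⟨(), s i b⟩ ⟨(), b⟩ ⟨i, rfl, h⟩)
      have : curry E = F' := by
        apply CoprodI.ext_hom
        intro i
        ext g b
        · change (curry E (CoprodI.of g)).left b = (F' (CoprodI.of g)).left b
          have hg : t i b = g * t i ((CoprodI.of g : CoprodI G)⁻¹ • b) := by
            have h0 := ht i ((CoprodI.of g : CoprodI G)⁻¹ • b)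
            rw [← map_inv, hs, map_inv, eq_inv_smul_iff, smul_smul, ← map_mul] at h0
            have h2 := hfree i ((t i b)⁻¹ * (g * t i ((CoprodI.of g : CoprodI G)⁻¹ • b))) (s i b)
              (by rw [map_mul, mul_smul, h0, map_inv, inv_smul_eq_iff, ht])
            exact inv_mul_eq_one.mp h2
          rw [hF'of, eq_mul_inv_iff_mul_eq, ← hlab, ← hlab, hg, map_mul, map_mul]
          conv_rhs => rw [SemidirectProduct.mul_left]
          rfl
        · exact (hF'right _).symm
      apply Functor.hext
      · intro
        apply Unit.ext
      · intro a b p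
        exact heq_of_eq ((hE' p).trans (by rw [this]; rfl))

open Monoid in
/-- A subgroup of a free product that meets no conjugate of a factor is free. -/
theorem Subgroup.isFreeGroup_of_coprodI {ι : Type u} {G : ι → Type u} [∀ i, Group (G i)]
    (N : Subgroup (CoprodI G))
    (hN : ∀ i (g : G i) (x : CoprodI G), x⁻¹ * CoprodI.of g * x ∈ N → g = 1) :
    IsFreeGroup N := by
  let r : ι → Setoid (CoprodI G ⧸ N) := fun i =>
    @MulAction.orbitRel (G i) _ _ (MulAction.compHom _ CoprodI.of)
  have hr : ∀ i a b, (r i).r a b ↔ ∃ g : G i, (CoprodI.of g : CoprodI G) • b = a :=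
    fun i a b => Iff.rfl
  let s : ι → CoprodI G ⧸ N → CoprodI G ⧸ N := fun i a => (Quotient.mk (r i) a).out
  have hex : ∀ i a, ∃ g : G i, (CoprodI.of g : CoprodI G) • s i a = a := fun i a =>
    (hr i _ _).mp ((r i).symm (Quotient.mk_out (s := r i) a))
  choose t ht using hex
  have hs : ∀ i (g : G i) a, s i ((CoprodI.of g : CoprodI G) • a) = s i a := fun i g a =>
    congrArg Quotient.out (Quotient.sound (s := r i) ((hr i _ _).mpr ⟨g, rfl⟩))
  have hfree : ∀ i (g : G i) (a : CoprodI G ⧸ N), (CoprodI.of g : CoprodI G) • a = a → g = 1 := by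
    intro i g a
    induction a using QuotientGroup.induction_on with
    | H x =>
      intro h
      refine hN i g x ?_
      have h' := QuotientGroup.eq.mp (h.symm : (x : CoprodI G ⧸ N) = (CoprodI.of g * x : CoprodI G))
      rw [mul_assoc]
      exact h'
  let := IsFreeGroupoid.actionCategoryCoprodI s t ht hs hfree
  have hconn : CategoryTheory.IsConnected
      (CategoryTheory.ActionCategory (CoprodI G) (CoprodI G ⧸ N)) := inferInstance
  have hend := @IsFreeGroupoid.endIsFreeOfConnectedFree _ _ hconn _
    (CategoryTheory.ActionCategory.objEquiv (CoprodI G) (CoprodI G ⧸ N) ((1 : CoprodI G) : _ ⧸ N))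
  exact @IsFreeGroup.ofMulEquiv _ _ hend _ _
    (CategoryTheory.ActionCategory.endMulEquivSubgroup N)

/-- Any subgroup of the free product `ℤ_K * ⋯ * ℤ_K` (`M` copies) contained in the
commutator subgroup is a free group. -/
theorem stmt2 (K M : ℕ) (hK : 1 ≤ K)
    (N : Subgroup (Monoid.CoprodI fun _ : Fin M => Multiplicative (ZMod K)))
    (hN : N ≤ commutator (Monoid.CoprodI fun _ : Fin M => Multiplicative (ZMod K))) :
    IsFreeGroup ↥N := by
  refine N.isFreeGroup_of_coprodI (G := fun _ => Multiplicative (ZMod K)) fun _ g x hx => ?_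
  let φ : (Monoid.CoprodI fun _ : Fin M => Multiplicative (ZMod K)) →* Multiplicative (ZMod K) :=
    Monoid.CoprodI.lift fun _ => MonoidHom.id (Multiplicative (ZMod K))
  have h : φ (x⁻¹ * Monoid.CoprodI.of (M := fun _ => Multiplicative (ZMod K)) g * x) = 1 :=
    Abelianization.commutator_subset_ker φ (hN hx)
  simpa [φ, mul_right_comm] using h
end

section
/- Let K ≥ 1 and M be natural numbers, and let Ω be the free product of M copies of the cyclic group ZMod K. Then the abelianization of the commutator subgroup ⁅Ω,Ω⁆ (equivalently, the quotient ⁅Ω,Ω⁆/⁅⁅Ω,Ω⁆,⁅Ω,Ω⁆⁆, which is the kernel of the map from the universal metabelian uniform group Ω/Ω'' onto (ZMod K)^M) is a finitely generated free abelian group, i.e., isomorphic to ℤ^r for some natural number r. -/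
open SemidirectProduct

section Lifting

variable {Ω A : Type*} [Group Ω] [Group A]

/-- Given `p : Ω →* A` with a set-theoretic section `s`, a homomorphism from `p.ker` to `B` induces
a homomorphism from `Ω` to the wreath product of `B` by `A` (Kaloujnine–Krasner). -/
def MonoidHom.kerInduced {B : Type*} [Group B] (p : Ω →* A) (s : A → Ω) (hs : ∀ a, p (s a) = a)
    (f : p.ker →* B) : Ω →* (A → B) ⋊[mulAutArrow] A :=
  MonoidHom.mk'
    (fun g => ⟨fun a => f ⟨(s a)⁻¹ * g * s ((p g)⁻¹ * a), by
      simp [MonoidHom.mem_ker, hs]⟩, p g⟩)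
    (fun g h => by
      ext a
      · simp only [mul_left, Pi.mul_apply, mulAutArrow_apply_apply]
        change _ = _ * f _
        rw [← map_mul f]
        refine congrArg f (Subtype.ext ?_)
        simp [mul_assoc]
      · simp)

/-- If `j : H →* A` has a retraction, then a homomorphism from `H` to the wreath product of `B` by `A`
which covers `j` is conjugate to the standard one: its left component is a coboundary. -/
theorem SemidirectProduct.exists_left_eq_of_retraction {H B : Type*} [Group H] [CommGroup B]
    (j : H →* A) (r : A →* H) (hr : ∀ x, r (j x) = x)
    (F : H →* (A → B) ⋊[mulAutArrow] A) (hF : ∀ x, (F x).right = j x) :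
    ∃ v : A → B, ∀ x a, (F x).left a = v a * (v ((j x)⁻¹ * a))⁻¹ := by
  refine ⟨fun a => (F (r a)).left a, fun x a => ?_⟩
  have h : F (r a) = F x * F (r ((j x)⁻¹ * a)) := by
    rw [← map_mul]
    simp [hr]
  rw [eq_mul_inv_iff_mul_eq]
  simp only [h, mul_left, Pi.mul_apply, hF]
  rfl

theorem SemidirectProduct.left_inl_mul_inr_mul_inl_inv {B : Type*} [Group B] (w : A → B)
    (g a : A) : (inl w * inr g * (inl w)⁻¹ : (A → B) ⋊[mulAutArrow] A).left a =
      w a * (w (g⁻¹ * a))⁻¹ := by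
  simp only [mul_left, right_inl, map_one, MulAut.one_apply, left_inr, mul_one, left_inl,
    mul_right, right_inr, one_mul, inv_left, inv_one, Pi.mul_apply, mulAutArrow_apply_apply]
  rfl

variable {ι : Type*} {G : ι → Type*} [∀ i, Group (G i)]

/-- If `p` is a surjection from a free product that restricts to a split injection on each factor,
then homomorphisms from `p.ker` to commutative groups lift along surjections. -/
theorem Monoid.CoprodI.exists_comp_eq_of_ker (p : CoprodI G →* A) (hp : Function.Surjective p)
    (r : ∀ i, A →* G i) (hr : ∀ i x, r i (p (of x)) = x)
    {B P : Type*} [CommGroup B] [CommGroup P] (q : P →* B) (hq : Function.Surjective q)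
    (f : p.ker →* B) : ∃ f' : p.ker →* P, q.comp f' = f := by
  obtain ⟨s, hs⟩ := hp.hasRightInverse
  have hv (i : ι) := exists_left_eq_of_retraction (p.comp of) (r i) (hr i)
    ((p.kerInduced s hs f).comp of) (fun _ => rfl)
  choose v hv using hv
  obtain ⟨t, ht⟩ := hq.hasRightInverse
  let F' : CoprodI G →* (A → P) ⋊[mulAutArrow] A := CoprodI.lift fun i =>
    (MulAut.conj (inl fun a => t (v i a))).toMonoidHom.comp (inr.comp (p.comp of))
  have hF' (g) : (F' g).right = p g := by
    have : rightHom.comp F' = p := by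
      ext i x
      simp [F']
    exact DFunLike.congr_fun this g
  let Q : (A → P) ⋊[mulAutArrow] A →* (A → B) ⋊[mulAutArrow] A :=
    SemidirectProduct.map (q.compLeft A) (MonoidHom.id A) (fun _ => rfl)
  have hQ : Q.comp F' = p.kerInduced s hs f := by
    ext i x a
    · have := hv i x a
      simp only [MonoidHom.comp_apply] at this ⊢
      rw [this]
      calc q ((F' (of x)).left a)
          = q (t (v i a) * (t (v i ((p (of x))⁻¹ * a)))⁻¹) := by
            simp only [F', lift_of]
            exact congrArg q (left_inl_mul_inr_mul_inl_inv _ _ _)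
        _ = v i a * (v i ((p (of x))⁻¹ * a))⁻¹ := by
            rw [map_mul, map_inv, ht, ht]
    · exact hF' _
  refine ⟨MonoidHom.mk' (fun n => (F' n).left 1) fun m n => ?_, ?_⟩
  · have hm : (F' m).right = 1 := (hF' m).trans m.2
    simp [hm]
  · ext n
    have hn : p n = 1 := n.2
    have h₁ : p (s 1) = 1 := hs 1
    have h : q ((F' n).left 1) = (p.kerInduced s hs f n).left 1 := by
      rw [← hQ]
      rfl
    refine h.trans ?_
    calc (p.kerInduced s hs f n).left 1 = f (⟨s 1, h₁⟩⁻¹ * n * ⟨s 1, h₁⟩) := by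
          refine congrArg f (Subtype.ext ?_)
          simp [hn]
      _ = f n := by simp [mul_comm]

theorem Monoid.CoprodI.projective_abelianization_ker (p : CoprodI G →* A)
    (hp : Function.Surjective p) (r : ∀ i, A →* G i) (hr : ∀ i x, r i (p (of x)) = x) :
    Module.Projective ℤ (Additive (Abelianization p.ker)) := by
  refine .of_lifting_property'' fun q hq => ?_
  obtain ⟨f, hf⟩ := exists_comp_eq_of_ker p hp r hr
    (AddMonoidHom.toMultiplicativeLeft q.toAddMonoidHom) hq Abelianization.of
  refine ⟨(MonoidHom.toAdditiveLeft (Abelianization.lift f)).toIntLinearMap, ?_⟩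
  have : (AddMonoidHom.toMultiplicativeLeft q.toAddMonoidHom).comp (Abelianization.lift f) =
      MonoidHom.id _ := by
    ext x
    exact DFunLike.congr_fun hf x
  ext x
  exact DFunLike.congr_fun this x.toMul

end Lifting

instance Monoid.CoprodI.group_fg {ι : Type*} [Finite ι] {G : ι → Type*} [∀ i, Group (G i)]
    [∀ i, Group.FG (G i)] : Group.FG (CoprodI G) := by
  have h := range_eq_iSup G (fun i => (of : G i →* CoprodI G))
  rw [lift_of', MonoidHom.range_eq_top_of_surjective _ Function.surjective_id] at h
  rw [Group.fg_def, h]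
  exact .iSup _ fun i => (Group.fg_iff_subgroup_fg _).1 inferInstance

theorem Monoid.CoprodI.pow_abelianization_eq_one {ι : Type*} {G : ι → Type*} [∀ i, Group (G i)]
    {n : ℕ} (h : ∀ i (x : G i), x ^ n = 1) (x : Abelianization (CoprodI G)) : x ^ n = 1 := by
  have : powMonoidHom n = (1 : Abelianization (CoprodI G) →* _) := by
    ext i y
    simp [← map_pow, h]
  exact DFunLike.congr_fun this x

/-- The abelianization of the commutator subgroup of the free product of `M` copies of
`ℤ_K` is a finitely generated free abelian group, i.e. isomorphic to `ℤ^r` for some `r`. -/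
theorem stmt3 (K M : ℕ) (hK : 1 ≤ K) :
    ∃ r : ℕ, Nonempty
      (Additive (Abelianization
          ↥(commutator (Monoid.CoprodI fun _ : Fin M => Multiplicative (ZMod K))))
        ≃+ (Fin r →₀ ℤ)) := by
  have : NeZero K := ⟨by lia⟩
  let Ω := Monoid.CoprodI fun _ : Fin M => Multiplicative (ZMod K)
  have hpow : ∀ x : Abelianization Ω, x ^ K = 1 :=
    Monoid.CoprodI.pow_abelianization_eq_one fun _ x => by
      rw [← toAdd_eq_zero]
      simp
  have : Group.FG (Abelianization Ω) :=
    Group.fg_of_surjective (f := Abelianization.of) (QuotientGroup.mk'_surjective _)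
  have : Finite (Abelianization Ω) := CommGroup.finite_of_fg_isMulTorsion _ fun x =>
    isOfFinOrder_iff_pow_eq_one.2 ⟨K, hK, hpow x⟩
  rw [← Abelianization.ker_of]
  have : Group.FG (Abelianization.of (G := Ω)).ker := inferInstance
  have : Group.FG (Abelianization (Abelianization.of (G := Ω)).ker) :=
    Group.fg_of_surjective (f := Abelianization.of) (QuotientGroup.mk'_surjective _)
  have : Module.Finite ℤ (Additive (Abelianization (Abelianization.of (G := Ω)).ker)) :=
    Module.Finite.iff_addGroup_fg.2 inferInstance
  have := Monoid.CoprodI.projective_abelianization_ker (Abelianization.of (G := Ω))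
    (QuotientGroup.mk'_surjective _)
    (fun i => Abelianization.lift (Monoid.CoprodI.lift (Pi.mulSingle i (MonoidHom.id _))))
    (fun i x => Monoid.CoprodI.of_leftInverse
      (M := fun _ : Fin M => Multiplicative (ZMod K)) i x)
  exact ⟨_, ⟨((Module.finBasis ℤ _).repr).toAddEquiv⟩⟩
end

section
/- Let K ≥ 1 be a natural number and let Ω = ZMod K * ZMod K be the free product of two copies of the cyclic group of order K. Then the abelianization of the commutator subgroup ⁅Ω,Ω⁆ is a free abelian group of rank (K−1)², i.e., isomorphic to ℤ^{(K−1)²}. -/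
/-- A homomorphism from `G` to a regular wreath product over a commutative group restricts to a
homomorphism from the commutator subgroup of `G` to the base of the wreath product. -/
def RegularWreathProduct.commutatorLeftHom {G D Q : Type*} [Group G] [Group D] [CommGroup Q]
    (F : G →* RegularWreathProduct D Q) : commutator G →* (Q → D) where
  toFun x := (F x).left
  map_one' := by simp
  map_mul' x y := by
    have hx : (F x).right = 1 :=
      Abelianization.commutator_subset_ker (RegularWreathProduct.rightHom.comp F) x.2
    ext q
    simp [hx]

namespace Monoid.CoprodI

open scoped commutatorElement

variable {M : Fin 2 → Type*} [∀ i, CommGroup (M i)]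

variable (M) in
/-- The homomorphism to a wreath product which is the standard inclusion on the first factor, and
a conjugate of the standard inclusion on the second factor. -/
noncomputable def toWreath [∀ i, DecidableEq (M i)] :
    CoprodI M →* RegularWreathProduct (Multiplicative ℤ) (∀ i, M i) :=
  lift fun i => (MulAut.conj ((⟨Pi.mulSingle 1 (Multiplicative.ofAdd (-1)), 1⟩ :
      RegularWreathProduct (Multiplicative ℤ) (∀ i, M i)) ^ (i : ℕ))).toMonoidHom.comp
    (RegularWreathProduct.inl.comp (MonoidHom.mulSingle M i))

/-- The image of `⁅a 0, a 1⁆` under `toWreath M` has coefficient `δ_{a, b}` at each `b` without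
trivial components. -/
theorem toWreath_commutator_left [∀ i, DecidableEq (M i)] (a b : ∀ i, M i) (hb : ∀ i, b i ≠ 1) :
    (toWreath M ⁅(of (a 0) : CoprodI M), (of (a 1) : CoprodI M)⁆).left b =
      Multiplicative.ofAdd (if a = b then 1 else 0) := by
  have h1 : b ≠ 1 := fun h => hb 0 (by simp [h])
  have h2 : (Pi.mulSingle 0 (a 0))⁻¹ * b ≠ 1 := fun h => hb 1 (by simpa using congrFun h 1)
  have h3 : (Pi.mulSingle 1 (a 1))⁻¹ * b ≠ 1 := fun h => hb 0 (by simpa using congrFun h 0)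
  have h4 : (Pi.mulSingle 1 (a 1))⁻¹ * ((Pi.mulSingle 0 (a 0))⁻¹ * b) = 1 ↔ a = b := by
    simp [funext_iff, Fin.forall_fin_two, inv_mul_eq_one, eq_inv_mul_iff_mul_eq]
  rw [toWreath, map_commutatorElement, lift_of, lift_of, commutatorElement_def]
  simp [Pi.mulSingle_apply, h2, h3, h4, h1]
  split_ifs <;> simp

/-- The subgroup generated by the commutators of elements of the two factors is normal. -/
theorem normal_closure_commutator_of :
    (Subgroup.closure (Set.range fun p : ∀ i, M i =>
      ⁅(of (p 0) : CoprodI M), (of (p 1) : CoprodI M)⁆)).Normal := by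
  set N := Subgroup.closure (Set.range fun p : ∀ i, M i =>
      ⁅(of (p 0) : CoprodI M), (of (p 1) : CoprodI M)⁆) with hN
  have mem (a : M 0) (b : M 1) : ⁅(of a : CoprodI M), (of b : CoprodI M)⁆ ∈ N :=
    Subgroup.subset_closure ⟨Fin.cons a (Fin.cons b finZeroElim), rfl⟩
  refine ⟨fun n hn g => ?_⟩
  induction g using CoprodI.induction_on generalizing n with
  | one => simpa using hn
  | mul x y hx hy => simpa [mul_assoc] using hx _ (hy _ hn)
  | of i m =>
    suffices h : N ≤ N.comap (MulAut.conj (of m : CoprodI M)).toMonoidHom from h hn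
    rw [hN, Subgroup.closure_le, ← hN]
    rintro _ ⟨p, rfl⟩
    change of m * ⁅(of (p 0) : CoprodI M), (of (p 1) : CoprodI M)⁆ * (of m)⁻¹ ∈ N
    obtain rfl | rfl : i = 0 ∨ i = 1 := by fin_cases i <;> simp
    · have : of m * ⁅(of (p 0) : CoprodI M), (of (p 1) : CoprodI M)⁆ * (of m)⁻¹ =
          ⁅(of (m * p 0) : CoprodI M), (of (p 1) : CoprodI M)⁆ *
            ⁅(of m : CoprodI M), (of (p 1) : CoprodI M)⁆⁻¹ := by
        simp only [map_mul]
        simp [commutatorElement_def, mul_assoc]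
      rw [this]
      exact mul_mem (mem _ _) (inv_mem (mem _ _))
    · have : of m * ⁅(of (p 0) : CoprodI M), (of (p 1) : CoprodI M)⁆ * (of m)⁻¹ =
          ⁅(of (p 0) : CoprodI M), (of m : CoprodI M)⁆⁻¹ *
            ⁅(of (p 0) : CoprodI M), (of (m * p 1) : CoprodI M)⁆ := by
        simp only [map_mul]
        simp [commutatorElement_def, mul_assoc]
      rw [this]
      exact mul_mem (inv_mem (mem _ _)) (mem _ _)

/-- The commutator subgroup of a free product of two commutative groups is generated by the
commutators of elements of the two factors. -/
theorem commutator_eq_closure_commutator_of :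
    commutator (CoprodI M) = Subgroup.closure (Set.range fun p : ∀ i, M i =>
      ⁅(of (p 0) : CoprodI M), (of (p 1) : CoprodI M)⁆) := by
  set N := Subgroup.closure (Set.range fun p : ∀ i, M i =>
      ⁅(of (p 0) : CoprodI M), (of (p 1) : CoprodI M)⁆) with hN
  have : N.Normal := normal_closure_commutator_of
  have key (x y : CoprodI M) :
      ⁅x, y⁆ ∈ N ↔ Commute (QuotientGroup.mk' N x) (QuotientGroup.mk' N y) := by
    rw [← commutatorElement_eq_one_iff_commute, ← map_commutatorElement]
    exact (QuotientGroup.eq_one_iff _).symm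
  have mem (a : M 0) (b : M 1) : ⁅(of a : CoprodI M), (of b : CoprodI M)⁆ ∈ N :=
    Subgroup.subset_closure ⟨Fin.cons a (Fin.cons b finZeroElim), rfl⟩
  refine le_antisymm ?_ ((Subgroup.closure_le _).2 ?_)
  · rw [commutator_def, Subgroup.commutator_le]
    rintro x - y -
    rw [key]
    induction x using CoprodI.induction_on with
    | one => simp
    | mul x x' hx hx' => simpa using hx.mul_left hx'
    | of i a =>
      induction y using CoprodI.induction_on with
      | one => simp
      | mul y y' hy hy' => simpa using hy.mul_right hy'
      | of j b =>
        by_cases hij : i = j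
        · subst hij
          exact ((Commute.all a b).map of).map _
        · obtain ⟨rfl, rfl⟩ | ⟨rfl, rfl⟩ : (i = 0 ∧ j = 1) ∨ (i = 1 ∧ j = 0) := by omega
          · exact (key _ _).1 (mem a b)
          · exact ((key _ _).1 (mem b a)).symm
  · rintro _ ⟨p, rfl⟩
    exact Subgroup.commutator_mem_commutator (Subgroup.mem_top _) (Subgroup.mem_top _)

/-- The class of the commutator of `p 0` and `p 1` in the abelianization of the commutator
subgroup. -/
def commutatorClass (p : ∀ i, M i) : Additive (Abelianization (commutator (CoprodI M))) :=
  Additive.ofMul (Abelianization.of ⟨⁅(of (p 0) : CoprodI M), (of (p 1) : CoprodI M)⁆,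
    Subgroup.commutator_mem_commutator (Subgroup.mem_top _) (Subgroup.mem_top _)⟩)

theorem commutatorClass_eq_zero {p : ∀ i, M i} {i : Fin 2} (h : p i = 1) :
    commutatorClass p = 0 := by
  have : ⁅(of (p 0) : CoprodI M), (of (p 1) : CoprodI M)⁆ = 1 := by
    obtain rfl | rfl : i = 0 ∨ i = 1 := by omega
    all_goals simp [h]
  simp only [commutatorClass, this]
  exact congrArg Additive.ofMul (map_one Abelianization.of)

theorem linearIndependent_commutatorClass :
    LinearIndependent ℤ fun p : ∀ i, {a : M i // a ≠ 1} =>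
      commutatorClass fun i => (p i : M i) := by
  classical
  let f : Additive (Abelianization (commutator (CoprodI M))) →+ ((∀ i, M i) → ℤ) :=
    MonoidHom.toAdditiveLeft (Abelianization.lift
      (RegularWreathProduct.commutatorLeftHom (toWreath M)))
  let g : ((∀ i, M i) → ℤ) →ₗ[ℤ] ((∀ i, {a : M i // a ≠ 1}) → ℤ) :=
    LinearMap.funLeft ℤ ℤ fun p i => (p i : M i)
  refine LinearIndependent.of_comp (g ∘ₗ f.toIntLinearMap) ?_
  have h : ⇑(g ∘ₗ f.toIntLinearMap) ∘ (fun p : ∀ i, {a : M i // a ≠ 1} =>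
      commutatorClass fun i => (p i : M i)) = fun p => Pi.single p 1 := by
    ext p q
    refine (congrArg Multiplicative.toAdd (toWreath_commutator_left (fun i => (p i : M i))
      (fun i => (q i : M i)) fun i => (q i).2)).trans ?_
    simp [Pi.single_apply, funext_iff, Subtype.ext_iff, eq_comm]
  rw [h]
  exact Pi.linearIndependent_single_one _ ℤ

theorem span_commutatorClass :
    Submodule.span ℤ (Set.range fun p : ∀ i, {a : M i // a ≠ 1} =>
      commutatorClass fun i => (p i : M i)) = ⊤ := by
  set S := Submodule.span ℤ (Set.range fun p : ∀ i, {a : M i // a ≠ 1} =>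
      commutatorClass fun i => (p i : M i))
  have hS (p : ∀ i, M i) : commutatorClass p ∈ S := by
    by_cases h : ∀ i, p i ≠ 1
    · exact Submodule.subset_span ⟨fun i => ⟨p i, h i⟩, rfl⟩
    · push Not at h
      obtain ⟨i, hi⟩ := h
      rw [commutatorClass_eq_zero hi]
      exact S.zero_mem
  refine eq_top_iff.2 fun x _ => ?_
  obtain ⟨⟨y, hy⟩, rfl⟩ : ∃ y, Additive.ofMul (Abelianization.of y) = x :=
    QuotientGroup.mk_surjective x
  have hle : commutator (CoprodI M) ≤
      (S.toAddSubgroup.toSubgroup'.comap Abelianization.of).map (commutator _).subtype := by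
    conv_lhs => rw [commutator_eq_closure_commutator_of]
    rw [Subgroup.closure_le]
    rintro _ ⟨p, rfl⟩
    exact ⟨_, hS p, rfl⟩
  obtain ⟨z, hz, rfl⟩ := hle hy
  exact hz

variable (M) in
/-- The abelianization of the commutator subgroup of a free product of two commutative groups is
free abelian on the commutators of nontrivial elements of the two factors. -/
noncomputable def commutatorBasis :
    Module.Basis (∀ i, {a : M i // a ≠ 1}) ℤ
      (Additive (Abelianization (commutator (CoprodI M)))) :=
  .mk linearIndependent_commutatorClass span_commutatorClass.ge

end Monoid.CoprodI

/-- The abelianization of the commutator subgroup of `ℤ_K * ℤ_K` is a free abelian group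
of rank `(K-1)²`. -/
theorem stmt4 (K : ℕ) (hK : 1 ≤ K) :
    Nonempty
      (Additive (Abelianization
          ↥(commutator (Monoid.CoprodI fun _ : Fin 2 => Multiplicative (ZMod K))))
        ≃+ (Fin ((K - 1) ^ 2) →₀ ℤ)) := by
  have : NeZero K := ⟨by omega⟩
  classical
  have e : (∀ _ : Fin 2, {a : Multiplicative (ZMod K) // a ≠ 1}) ≃ Fin ((K - 1) ^ 2) :=
    Fintype.equivFinOfCardEq (by simp [Fintype.card_subtype_compl, ZMod.card])
  exact ⟨((Monoid.CoprodI.commutatorBasis fun _ : Fin 2 => Multiplicative (ZMod K)).reindex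
    e).repr.toAddEquiv⟩
end

section
/- Let K be a prime number and let H be the Heisenberg group over ZMod K, i.e., the set (ZMod K) × (ZMod K) × (ZMod K) with multiplication (a,b,c)·(a',b',c') = (a+a', b+b', c+c'+a·b'). Let z = (0,0,1), which is a central element of H. Then for every irreducible finite-dimensional complex representation ρ of H on a nonzero complex vector space V, there exists a scalar ζ ∈ ℂ with ζ^K = 1 such that ρ(z) = ζ · id_V; moreover ζ = 1 if and only if dim_ℂ V = 1. -/
/-- The Heisenberg group over `ZMod K`: the set `(ZMod K) × (ZMod K) × (ZMod K)` with
multiplication `(a,b,c)·(a',b',c') = (a+a', b+b', c+c'+a·b')`. -/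
@[ext]
structure Heisenberg (K : ℕ) where
  a : ZMod K
  b : ZMod K
  c : ZMod K

namespace Heisenberg

variable {K : ℕ}

instance : Mul (Heisenberg K) :=
  ⟨fun x y => ⟨x.a + y.a, x.b + y.b, x.c + y.c + x.a * y.b⟩⟩

instance : One (Heisenberg K) := ⟨⟨0, 0, 0⟩⟩

instance : Inv (Heisenberg K) :=
  ⟨fun x => ⟨-x.a, -x.b, -x.c + x.a * x.b⟩⟩

@[simp] lemma mul_a (x y : Heisenberg K) : (x * y).a = x.a + y.a := rfl
@[simp] lemma mul_b (x y : Heisenberg K) : (x * y).b = x.b + y.b := rfl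
@[simp] lemma mul_c (x y : Heisenberg K) : (x * y).c = x.c + y.c + x.a * y.b := rfl
@[simp] lemma one_a : (1 : Heisenberg K).a = 0 := rfl
@[simp] lemma one_b : (1 : Heisenberg K).b = 0 := rfl
@[simp] lemma one_c : (1 : Heisenberg K).c = 0 := rfl
@[simp] lemma inv_a (x : Heisenberg K) : x⁻¹.a = -x.a := rfl
@[simp] lemma inv_b (x : Heisenberg K) : x⁻¹.b = -x.b := rfl
@[simp] lemma inv_c (x : Heisenberg K) : x⁻¹.c = -x.c + x.a * x.b := rfl

instance : Group (Heisenberg K) where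
  mul_assoc x y z := by ext <;> simp <;> ring
  one_mul x := by ext <;> simp
  mul_one x := by ext <;> simp
  inv_mul_cancel x := by ext <;> simp <;> ring

end Heisenberg

namespace LinearMap.GeneralLinearGroup

/-- Schur's lemma: an endomorphism commuting with an irreducible representation on a nonzero
finite-dimensional vector space over an algebraically closed field is a scalar. -/
theorem exists_eq_smul_id_of_irreducible {k G V : Type*} [Field k] [IsAlgClosed k] [Group G]
    [AddCommGroup V] [Module k V] [FiniteDimensional k V] [Nontrivial V]
    (ρ : G →* LinearMap.GeneralLinearGroup k V)
    (hirr : ∀ W : Submodule k V,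
      (∀ g : G, ∀ v ∈ W, (ρ g : V →ₗ[k] V) v ∈ W) → W = ⊥ ∨ W = ⊤)
    (f : Module.End k V) (hf : ∀ g, Commute f (ρ g : Module.End k V)) :
    ∃ μ : k, f = μ • (LinearMap.id : V →ₗ[k] V) := by
  obtain ⟨μ, hμ⟩ := Module.End.exists_eigenvalue f
  refine ⟨μ, ?_⟩
  have hinv (g : G) (v : V) (hv : v ∈ f.eigenspace μ) :
      (ρ g : V →ₗ[k] V) v ∈ f.eigenspace μ := by
    rw [Module.End.mem_eigenspace_iff] at hv ⊢
    rw [← Module.End.mul_apply, (hf g).eq, Module.End.mul_apply, hv, map_smul]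
  have htop := (hirr _ hinv).resolve_left hμ
  ext v
  exact Module.End.mem_eigenspace_iff.1 (htop ▸ Submodule.mem_top)

/-- An irreducible representation with commuting operators on a nonzero finite-dimensional vector
space over an algebraically closed field is one-dimensional. -/
theorem finrank_eq_one_of_irreducible_of_commute {k G V : Type*} [Field k] [IsAlgClosed k]
    [Group G] [AddCommGroup V] [Module k V] [FiniteDimensional k V] [Nontrivial V]
    (ρ : G →* LinearMap.GeneralLinearGroup k V)
    (hirr : ∀ W : Submodule k V,
      (∀ g : G, ∀ v ∈ W, (ρ g : V →ₗ[k] V) v ∈ W) → W = ⊥ ∨ W = ⊤)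
    (hcomm : ∀ g h, Commute (ρ g) (ρ h)) : Module.finrank k V = 1 := by
  obtain ⟨v, hv⟩ := exists_ne (0 : V)
  have hinv (g : G) (w : V) (hw : w ∈ Submodule.span k {v}) :
      (ρ g : V →ₗ[k] V) w ∈ Submodule.span k {v} := by
    obtain ⟨μ, hμ⟩ := exists_eq_smul_id_of_irreducible ρ hirr (ρ g : Module.End k V)
      fun h => (hcomm g h).units_val
    rw [hμ]
    exact Submodule.smul_mem _ μ hw
  have htop := (hirr _ hinv).resolve_left (by simpa using hv)
  rw [← finrank_top, ← htop, finrank_span_singleton hv]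

/-- Linear automorphisms of a one-dimensional vector space commute. -/
theorem commute_of_finrank_eq_one {k V : Type*} [Field k] [AddCommGroup V] [Module k V]
    (hV : Module.finrank k V = 1) (f g : LinearMap.GeneralLinearGroup k V) : Commute f g := by
  obtain ⟨v, hv, hspan⟩ := finrank_eq_one_iff'.1 hV
  obtain ⟨a, ha⟩ := hspan ((f : V →ₗ[k] V) v)
  obtain ⟨b, hb⟩ := hspan ((g : V →ₗ[k] V) v)
  refine Units.ext (LinearMap.ext fun w => ?_)
  obtain ⟨c, rfl⟩ := hspan w
  simp only [Units.val_mul, Module.End.mul_apply, map_smul, ← ha, ← hb]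
  rw [smul_comm a b]

end LinearMap.GeneralLinearGroup

namespace Heisenberg

variable {K : ℕ}

theorem mk_mem_center (c : ZMod K) : (⟨0, 0, c⟩ : Heisenberg K) ∈ Subgroup.center _ :=
  Subgroup.mem_center_iff.2 fun g => by ext <;> simp [add_comm]

theorem mk_one_pow (n : ℕ) : (⟨0, 0, 1⟩ : Heisenberg K) ^ n = ⟨0, 0, n⟩ := by
  induction n with
  | zero => ext <;> simp
  | succ n ih => rw [pow_succ, ih]; ext <;> simp

theorem mk_one_pow_self : (⟨0, 0, 1⟩ : Heisenberg K) ^ K = 1 := by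
  rw [mk_one_pow]; ext <;> simp

theorem mul_eq_mk_mul_mul (g h : Heisenberg K) :
    g * h = ⟨0, 0, g.a * h.b - h.a * g.b⟩ * (h * g) := by
  ext <;> simp <;> ring

/-- A homomorphism from the Heisenberg group kills `(0,0,1)` iff its image is commutative. -/
theorem map_mk_one_eq_one_iff [NeZero K] {M : Type*} [Group M] (φ : Heisenberg K →* M) :
    φ ⟨0, 0, 1⟩ = 1 ↔ ∀ g h, Commute (φ g) (φ h) := by
  constructor
  · intro hz g h
    have hc (c : ZMod K) : φ ⟨0, 0, c⟩ = 1 := by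
      rw [← ZMod.natCast_zmod_val c, ← mk_one_pow, map_pow, hz, one_pow]
    rw [Commute, SemiconjBy, ← map_mul, ← map_mul, mul_eq_mk_mul_mul, map_mul, hc, one_mul]
  · intro hcomm
    have h := (hcomm ⟨1, 0, 0⟩ ⟨0, 1, 0⟩).eq
    rw [← map_mul, ← map_mul, mul_eq_mk_mul_mul, map_mul] at h
    simpa using h

end Heisenberg

/-- For a prime `K`, the element `z = (0,0,1)` is central in the Heisenberg group `H`
over `ZMod K`, and every irreducible finite-dimensional complex representation `ρ` of
`H` sends `z` to a scalar `ζ` with `ζ^K = 1`; moreover `ζ = 1` iff the representation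
is one-dimensional. -/
theorem stmt9 (K : ℕ) (hK : K.Prime) (V : Type*) [AddCommGroup V] [Module ℂ V]
    [FiniteDimensional ℂ V] [Nontrivial V]
    (ρ : Heisenberg K →* LinearMap.GeneralLinearGroup ℂ V)
    (hirr : ∀ W : Submodule ℂ V,
      (∀ g : Heisenberg K, ∀ v ∈ W, (ρ g : V →ₗ[ℂ] V) v ∈ W) → W = ⊥ ∨ W = ⊤) :
    (⟨0, 0, 1⟩ : Heisenberg K) ∈ Subgroup.center (Heisenberg K) ∧
    ∃ ζ : ℂ, ζ ^ K = 1 ∧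
      ((ρ ⟨0, 0, 1⟩ : V →ₗ[ℂ] V) = ζ • (LinearMap.id : V →ₗ[ℂ] V)) ∧
      (ζ = 1 ↔ Module.finrank ℂ V = 1) := by
  have : NeZero K := ⟨hK.ne_zero⟩
  have hz := Heisenberg.mk_mem_center (1 : ZMod K)
  obtain ⟨ζ, hζ⟩ := LinearMap.GeneralLinearGroup.exists_eq_smul_id_of_irreducible ρ hirr
    (ρ ⟨0, 0, 1⟩ : Module.End ℂ V) fun g =>
      (Commute.map (Subgroup.mem_center_iff.1 hz g).symm ρ).units_val
  have hinj : Function.Injective fun a : ℂ => a • (1 : Module.End ℂ V) :=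
    smul_left_injective ℂ one_ne_zero
  change (ρ ⟨0, 0, 1⟩ : Module.End ℂ V) = ζ • (1 : Module.End ℂ V) at hζ
  refine ⟨hz, ζ, hinj ?_, hζ, ?_⟩
  · change ζ ^ K • (1 : Module.End ℂ V) = (1 : ℂ) • 1
    rw [← one_pow K, ← smul_pow, ← hζ, ← Units.val_pow_eq_pow_val, ← map_pow,
      Heisenberg.mk_one_pow_self, map_one, Units.val_one, one_pow, one_smul]
  · have hone : ζ = 1 ↔ ρ ⟨0, 0, 1⟩ = 1 := by
      rw [← hinj.eq_iff, Units.ext_iff, hζ, Units.val_one, one_smul]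
    rw [hone, Heisenberg.map_mk_one_eq_one_iff]
    exact ⟨LinearMap.GeneralLinearGroup.finrank_eq_one_of_irreducible_of_commute ρ hirr,
      fun hV g h => LinearMap.GeneralLinearGroup.commute_of_finrank_eq_one hV (ρ g) (ρ h)⟩
end

section
/- Let K be a prime number and let H be the Heisenberg group over ZMod K, i.e., the set (ZMod K) × (ZMod K) × (ZMod K) with multiplication (a,b,c)·(a',b',c') = (a+a', b+b', c+c'+a·b'). Then every irreducible finite-dimensional complex representation of H has dimension 1 or K. -/
namespace Heisenberg

variable {K : ℕ}

lemma center_pow (d : ZMod K) (n : ℕ) :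
    (⟨0, 0, d⟩ : Heisenberg K) ^ n = ⟨0, 0, n * d⟩ := by
  induction n with
  | zero => ext <;> simp
  | succ n ih =>
    rw [pow_succ, ih]
    ext <;> simp
    ring

lemma b_pow (n : ℕ) : (⟨0, 1, 0⟩ : Heisenberg K) ^ n = ⟨0, n, 0⟩ := by
  induction n with
  | zero => ext <;> simp
  | succ n ih =>
    rw [pow_succ, ih]
    ext <;> simp

lemma center_comm (c : ZMod K) (g : Heisenberg K) : ⟨0, 0, c⟩ * g = g * ⟨0, 0, c⟩ := by
  ext <;> simp
  ring

lemma mul_eq_mul_comm_mul_center (g h : Heisenberg K) :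
    g * h = h * g * ⟨0, 0, g.a * h.b - h.a * g.b⟩ := by
  ext <;> simp <;> ring

lemma mul_a_eq (g : Heisenberg K) (j : ZMod K) :
    g * ⟨j, 0, 0⟩ = ⟨g.a + j, 0, 0⟩ * ⟨0, g.b, 0⟩ * ⟨0, 0, g.c - (g.a + j) * g.b⟩ := by
  ext <;> simp

variable {V : Type*} [AddCommGroup V] [Module ℂ V] [Nontrivial V]

/-- The Schur lemma over `ℂ`, for a monoid acting irreducibly. -/
lemma exists_scalar_of_commute [FiniteDimensional ℂ V] {G : Type*} [Monoid G] (σ : G →* Module.End ℂ V)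
    (hirr : ∀ W : Submodule ℂ V, (∀ g : G, ∀ v ∈ W, σ g v ∈ W) → W = ⊥ ∨ W = ⊤)
    (T : Module.End ℂ V) (hT : ∀ g, T * σ g = σ g * T) : ∃ z : ℂ, ∀ v, T v = z • v := by
  obtain ⟨z, hz⟩ := Module.End.exists_eigenvalue T
  refine ⟨z, fun v => ?_⟩
  have htop := (hirr (Module.End.eigenspace T z) fun g v hv => ?_).resolve_left hz
  · exact Module.End.mem_eigenspace_iff.1 (htop ▸ Submodule.mem_top)
  · rw [Module.End.mem_eigenspace_iff] at hv ⊢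
    have := LinearMap.congr_fun (hT g) v
    simpa [hv] using this

lemma finrank_eq_one_of_scalar {G : Type*} [Monoid G] (σ : G →* Module.End ℂ V)
    (hirr : ∀ W : Submodule ℂ V, (∀ g : G, ∀ v ∈ W, σ g v ∈ W) → W = ⊥ ∨ W = ⊤)
    (hσ : ∀ g, ∃ z : ℂ, ∀ v, σ g v = z • v) : Module.finrank ℂ V = 1 := by
  obtain ⟨v, hv⟩ := exists_ne (0 : V)
  have htop := (hirr (Submodule.span ℂ {v}) fun g w hw => ?_).resolve_left
    fun h => hv (Submodule.span_singleton_eq_bot.1 h)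
  · rw [← finrank_top ℂ, ← htop, finrank_span_singleton hv]
  · obtain ⟨z, hz⟩ := hσ g
    rw [hz]
    exact Submodule.smul_mem _ _ hw

lemma eq_one_of_center_eq_one [Fact K.Prime] {M : Type*} [Monoid M] (σ : Heisenberg K →* M)
    {d : ZMod K} (hd : d ≠ 0) (h : σ ⟨0, 0, d⟩ = 1) (c : ZMod K) : σ ⟨0, 0, c⟩ = 1 := by
  have : (⟨0, 0, c⟩ : Heisenberg K) = ⟨0, 0, d⟩ ^ (c / d).val := by
    rw [center_pow, ZMod.natCast_zmod_val, div_mul_cancel₀ _ hd]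
  rw [this, map_pow, h, one_pow]

lemma finrank_eq_of_center_ne_one [FiniteDimensional ℂ V] [Fact K.Prime]
    (σ : Heisenberg K →* Module.End ℂ V)
    (hirr : ∀ W : Submodule ℂ V, (∀ g, ∀ v ∈ W, σ g v ∈ W) → W = ⊥ ∨ W = ⊤)
    {c₀ : ZMod K} (hc₀ : σ ⟨0, 0, c₀⟩ ≠ 1) : Module.finrank ℂ V = K := by
  have hcen (c : ZMod K) : ∃ z : ℂ, ∀ v, σ ⟨0, 0, c⟩ v = z • v :=
    exists_scalar_of_commute σ hirr _ fun g => by rw [← map_mul, center_comm, map_mul]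
  choose χ hχ using hcen
  have inv_apply (g : Heisenberg K) (v : V) : σ g⁻¹ (σ g v) = v := by
    rw [← Module.End.mul_apply, ← map_mul, inv_mul_cancel, map_one, Module.End.one_apply]
  have hχ_inj : Function.Injective χ := by
    intro i j hij
    by_contra hne
    refine hc₀ (eq_one_of_center_eq_one σ (sub_ne_zero.2 hne) ?_ c₀)
    have hmul : (⟨0, 0, i - j⟩ : Heisenberg K) = ⟨0, 0, j⟩⁻¹ * ⟨0, 0, i⟩ := by
      ext <;> simp
      ring
    ext v
    rw [hmul, map_mul, Module.End.mul_apply, hχ i, hij, ← hχ j, inv_apply, Module.End.one_apply]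
  obtain ⟨z, hz⟩ := Module.End.exists_eigenvalue (σ ⟨0, 1, 0⟩)
  obtain ⟨v, hv⟩ := hz.exists_hasEigenvector
  have apply_ne (g : Heisenberg K) {w : V} (hw : w ≠ 0) : σ g w ≠ 0 := fun h => by
    have := inv_apply g w
    rw [h, map_zero] at this
    exact hw this.symm
  have hz0 : z ≠ 0 := by
    rintro rfl
    exact apply_ne ⟨0, 1, 0⟩ hv.2 (by rw [hv.apply_eq_smul, zero_smul])
  have hb (b : ZMod K) : σ ⟨0, b, 0⟩ v = z ^ b.val • v := by
    rw [← hv.pow_apply, ← map_pow, b_pow, ZMod.natCast_zmod_val]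
  have hact (g : Heisenberg K) (j : ZMod K) : σ g (σ ⟨j, 0, 0⟩ v) =
      (χ (g.c - (g.a + j) * g.b) * z ^ g.b.val) • σ ⟨g.a + j, 0, 0⟩ v := by
    rw [← Module.End.mul_apply, ← map_mul, mul_a_eq, map_mul, map_mul, Module.End.mul_apply,
      Module.End.mul_apply, hχ, map_smul, map_smul, hb, map_smul, smul_smul]
  have hli : LinearIndependent ℂ fun j : ZMod K => σ ⟨j, 0, 0⟩ v := by
    refine Module.End.eigenvectors_linearIndependent' (σ ⟨0, 1, 0⟩)
      (fun j => χ (-j) * z ^ (1 : ZMod K).val) (fun i j hij => ?_) _ fun j => ?_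
    · exact neg_injective (hχ_inj (mul_right_cancel₀ (pow_ne_zero _ hz0) hij))
    · refine ⟨Module.End.mem_eigenspace_iff.2 ?_, apply_ne _ hv.2⟩
      simpa using hact ⟨0, 1, 0⟩ j
  have hspan : Submodule.span ℂ (Set.range fun j : ZMod K => σ ⟨j, 0, 0⟩ v) = ⊤ := by
    refine (hirr _ fun g w hw => ?_).resolve_left fun h => ?_
    · induction hw using Submodule.span_induction with
      | mem x hx =>
        obtain ⟨j, rfl⟩ := hx
        simp only [hact]
        exact Submodule.smul_mem _ _ (Submodule.subset_span ⟨_, rfl⟩)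
      | zero => simp
      | add x y _ _ hx hy => rw [map_add]; exact Submodule.add_mem _ hx hy
      | smul a x _ hx => rw [map_smul]; exact Submodule.smul_mem _ _ hx
    · exact apply_ne _ hv.2 ((Submodule.span_eq_bot.1 h) _ ⟨0, rfl⟩)
  rw [Module.finrank_eq_card_basis (Module.Basis.mk hli hspan.ge), ZMod.card]

end Heisenberg

/-- For a prime `K`, every irreducible finite-dimensional complex representation of the
Heisenberg group over `ZMod K` has dimension `1` or `K`. -/
theorem stmt10 (K : ℕ) (hK : K.Prime) (V : Type*) [AddCommGroup V] [Module ℂ V]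
    [FiniteDimensional ℂ V] [Nontrivial V]
    (ρ : Heisenberg K →* LinearMap.GeneralLinearGroup ℂ V)
    (hirr : ∀ W : Submodule ℂ V,
      (∀ g : Heisenberg K, ∀ v ∈ W, (ρ g : V →ₗ[ℂ] V) v ∈ W) → W = ⊥ ∨ W = ⊤) :
    Module.finrank ℂ V = 1 ∨ Module.finrank ℂ V = K := by
  have : Fact K.Prime := ⟨hK⟩
  let σ : Heisenberg K →* Module.End ℂ V := (Units.coeHom _).comp ρ
  by_cases h : ∀ c : ZMod K, σ ⟨0, 0, c⟩ = 1
  · refine .inl (Heisenberg.finrank_eq_one_of_scalar σ hirr fun g =>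
      Heisenberg.exists_scalar_of_commute σ hirr _ fun k => ?_)
    rw [← map_mul, Heisenberg.mul_eq_mul_comm_mul_center, map_mul, h, mul_one, map_mul]
  · obtain ⟨c, hc⟩ := not_forall.1 h
    exact .inr (Heisenberg.finrank_eq_of_center_ne_one σ hirr hc)
end

section
/- Let m = !![0,1;1,1] be the 2×2 matrix over ZMod 2 (i.e., over 𝔽₂), and let A = m ⊗ 1 and B = 1 ⊗ m be the 4×4 Kronecker products over ZMod 2, acting on V = (Fin 2 × Fin 2) → ZMod 2 by matrix-vector multiplication. Consider the action on V of the submonoid (equivalently subgroup, since A³ = B³ = 1) generated by A and B. Then this action has exactly four orbits: {0}; the set S₁ of nonzero vectors fixed by A·B, which has exactly 3 elements; the set S₂ of nonzero vectors fixed by A·B·B, which has exactly 3 elements; and the complement of {0} ∪ S₁ ∪ S₂, which is a single orbit with exactly 9 elements. -/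
/-- The vector space `(𝔽₂)⁴` indexed by `Fin 2 × Fin 2`. -/
abbrev V02 := (Fin 2 × Fin 2) → ZMod 2

/-- The matrix `m = !![0,1;1,1]` over `𝔽₂`. -/
def mmat : Matrix (Fin 2) (Fin 2) (ZMod 2) := !![0, 1; 1, 1]

/-- `A = m ⊗ 1` acting on `(𝔽₂)⁴`. -/
def Amat : Matrix (Fin 2 × Fin 2) (Fin 2 × Fin 2) (ZMod 2) :=
  Matrix.kroneckerMap (· * ·) mmat (1 : Matrix (Fin 2) (Fin 2) (ZMod 2))

/-- `B = 1 ⊗ m` acting on `(𝔽₂)⁴`. -/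
def Bmat : Matrix (Fin 2 × Fin 2) (Fin 2 × Fin 2) (ZMod 2) :=
  Matrix.kroneckerMap (· * ·) (1 : Matrix (Fin 2) (Fin 2) (ZMod 2)) mmat

/-- The orbit of a vector `v` under the submonoid generated by `A` and `B`. -/
def orb (v : V02) : Set V02 :=
  { w | ∃ g ∈ Submonoid.closure
      ({Amat, Bmat} : Set (Matrix (Fin 2 × Fin 2) (Fin 2 × Fin 2) (ZMod 2))),
      w = g.mulVec v }

/-- The singleton orbit `{0}`. -/
def S0 : Set V02 := {0}

/-- The nonzero vectors fixed by `A·B`. -/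
def S1 : Set V02 := { v | v ≠ 0 ∧ (Amat * Bmat).mulVec v = v }

/-- The nonzero vectors fixed by `A·B·B`. -/
def S2 : Set V02 := { v | v ≠ 0 ∧ (Amat * Bmat * Bmat).mulVec v = v }

/-- The complement of `{0} ∪ S₁ ∪ S₂`. -/
def S3 : Set V02 := (S0 ∪ S1 ∪ S2)ᶜ

theorem Amat_pow_three : Amat ^ 3 = 1 := by decide +kernel

theorem Bmat_pow_three : Bmat ^ 3 = 1 := by decide +kernel

theorem Amat_Bmat_commute : Commute Amat Bmat := by
  unfold Commute SemiconjBy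
  decide +kernel

/-- Orbits are computed by the nine products `A ^ i * B ^ j` with `i, j < 3`. -/
theorem mem_orb_iff (v w : V02) :
    w ∈ orb v ↔ ∃ i j : Fin 3, w = (Amat ^ (i : ℕ) * Bmat ^ (j : ℕ)).mulVec v := by
  constructor
  · rintro ⟨g, hg, rfl⟩
    suffices h : ∃ i j : ℕ, g = Amat ^ i * Bmat ^ j by
      obtain ⟨i, j, rfl⟩ := h
      refine ⟨⟨i % 3, Nat.mod_lt _ (by norm_num)⟩, ⟨j % 3, Nat.mod_lt _ (by norm_num)⟩, ?_⟩
      rw [pow_eq_pow_mod i Amat_pow_three, pow_eq_pow_mod j Bmat_pow_three]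
    induction hg using Submonoid.closure_induction with
    | mem x hx =>
      rcases hx with rfl | rfl
      · exact ⟨1, 0, by simp⟩
      · exact ⟨0, 1, by simp⟩
    | one => exact ⟨0, 0, by simp⟩
    | mul x y _ _ hx hy =>
      obtain ⟨i, j, rfl⟩ := hx
      obtain ⟨k, l, rfl⟩ := hy
      refine ⟨i + k, j + l, ?_⟩
      rw [pow_add, pow_add]
      exact ((Amat_Bmat_commute.pow_pow k j).symm).mul_mul_mul_comm _ _
  · rintro ⟨i, j, rfl⟩
    exact ⟨_, mul_mem (pow_mem (Submonoid.subset_closure (by simp)) _)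
      (pow_mem (Submonoid.subset_closure (by simp)) _), rfl⟩

instance (v : V02) : DecidablePred (· ∈ orb v) :=
  fun w => decidable_of_iff' _ (mem_orb_iff v w)

instance : DecidablePred (· ∈ S0) :=
  fun v => inferInstanceAs (Decidable (v = 0))

instance : DecidablePred (· ∈ S1) :=
  fun v => inferInstanceAs (Decidable (v ≠ 0 ∧ (Amat * Bmat).mulVec v = v))

instance : DecidablePred (· ∈ S2) :=
  fun v => inferInstanceAs (Decidable (v ≠ 0 ∧ (Amat * Bmat * Bmat).mulVec v = v))

instance : DecidablePred (· ∈ S3) :=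
  fun v => inferInstanceAs (Decidable (¬ ((v ∈ S0 ∨ v ∈ S1) ∨ v ∈ S2)))

theorem orb_eq_S0 : ∀ v ∈ S0, orb v = S0 := by
  simp only [Set.ext_iff]
  decide +kernel

theorem orb_eq_S1 : ∀ v ∈ S1, orb v = S1 := by
  simp only [Set.ext_iff]
  decide +kernel

theorem orb_eq_S2 : ∀ v ∈ S2, orb v = S2 := by
  simp only [Set.ext_iff]
  decide +kernel

theorem orb_eq_S3 : ∀ v ∈ S3, orb v = S3 := by
  simp only [Set.ext_iff]
  decide +kernel

theorem S1_ncard : S1.ncard = 3 := by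
  rw [Set.ncard_eq_toFinset_card']
  decide +kernel

theorem S2_ncard : S2.ncard = 3 := by
  rw [Set.ncard_eq_toFinset_card']
  decide +kernel

theorem S3_ncard : S3.ncard = 9 := by
  rw [Set.ncard_eq_toFinset_card']
  decide +kernel

theorem S1_ne_S2 : S1 ≠ S2 := by
  rw [Ne, Set.ext_iff]
  decide +kernel

/-- The action of the submonoid generated by `A = m ⊗ 1` and `B = 1 ⊗ m` on `(𝔽₂)⁴`
has exactly four orbits: `{0}`, the set `S₁` of nonzero vectors fixed by `A·B` (with 3
elements), the set `S₂` of nonzero vectors fixed by `A·B·B` (with 3 elements), and the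
complement `S₃`, a single orbit with 9 elements. -/
theorem stmt11 :
    { S : Set V02 | ∃ v : V02, S = orb v } = {S0, S1, S2, S3} ∧
    S1 ≠ S2 ∧ S1.ncard = 3 ∧ S2.ncard = 3 ∧ S3.ncard = 9 := by
  refine ⟨?_, S1_ne_S2, S1_ncard, S2_ncard, S3_ncard⟩
  ext S
  simp only [Set.mem_ofPred_eq, Set.mem_insert_iff, Set.mem_singleton_iff]
  constructor
  · rintro ⟨v, rfl⟩
    by_cases h : v ∈ S0 ∪ S1 ∪ S2
    · rcases h with (h | h) | h
      · exact .inl (orb_eq_S0 v h)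
      · exact .inr (.inl (orb_eq_S1 v h))
      · exact .inr (.inr (.inl (orb_eq_S2 v h)))
    · exact .inr (.inr (.inr (orb_eq_S3 v h)))
  · rintro (rfl | rfl | rfl | rfl)
    · exact ⟨0, (orb_eq_S0 0 rfl).symm⟩
    · obtain ⟨v, hv⟩ := Set.nonempty_of_ncard_ne_zero (s := S1) (by simp [S1_ncard])
      exact ⟨v, (orb_eq_S1 v hv).symm⟩
    · obtain ⟨v, hv⟩ := Set.nonempty_of_ncard_ne_zero (s := S2) (by simp [S2_ncard])
      exact ⟨v, (orb_eq_S2 v hv).symm⟩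
    · obtain ⟨v, hv⟩ := Set.nonempty_of_ncard_ne_zero (s := S3) (by simp [S3_ncard])
      exact ⟨v, (orb_eq_S3 v hv).symm⟩
end

section
/- Let Γ be a group, K ≥ 1 a natural number, and x, y ∈ Γ with x^K = 1 and y^K = 1. Let H be a subgroup of Γ such that the elements 1, x, x², ..., x^{K−1} form a complete set of representatives of the left cosets of H in Γ, and likewise 1, y, y², ..., y^{K−1} form a complete set of representatives of the left cosets of H in Γ. Let χ : H →* ℂˣ be a group homomorphism. Then there exists a representation ρ : Γ →* GL(ℂ^K) (on the K-dimensional complex vector space Fin K → ℂ) such that the characteristic polynomials of ρ(x) and of ρ(y) (as linear maps, equivalently as K×K complex matrices) both equal X^K − 1, and there is a nonzero vector v ∈ ℂ^K with ρ(h) v = χ(h) • v for all h ∈ H. -/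
open Polynomial in
/-- An endomorphism of order dividing `K` of a `K`-dimensional space that admits a cyclic vector
has characteristic polynomial `X ^ K - 1`. -/
theorem LinearMap.charpoly_eq_X_pow_sub_one {F V : Type*} [Field F] [AddCommGroup V] [Module F V]
    [FiniteDimensional F V] {K : ℕ} (hK : K ≠ 0) (hV : Module.finrank F V = K)
    (f : Module.End F V) (hf : f ^ K = 1) (v : V)
    (hv : LinearIndependent F fun i : Fin K => (f ^ (i : ℕ)) v) :
    f.charpoly = X ^ K - 1 := by
  have hdeg : K ≤ (minpoly F f).natDegree := by
    by_contra! hlt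
    have h0 : ∑ i : Fin K, (minpoly F f).coeff i • (f ^ (i : ℕ)) v = 0 := by
      have h := congrArg (fun g : Module.End F V => g v) (minpoly.aeval F f)
      rw [aeval_eq_sum_range' hlt, ← Fin.sum_univ_eq_sum_range
        (fun i => (minpoly F f).coeff i • f ^ i)] at h
      simpa using h
    have hc := Fintype.linearIndependent_iff.1 hv _ h0 ⟨_, hlt⟩
    exact minpoly.ne_zero (Algebra.IsIntegral.isIntegral f) (leadingCoeff_eq_zero.1 hc)
  have hmonic := minpoly.monic (Algebra.IsIntegral.isIntegral (R := F) f)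
  have hchar : f.charpoly = minpoly F f :=
    (eq_of_monic_of_dvd_of_natDegree_le hmonic f.charpoly_monic f.minpoly_dvd_charpoly
      (by rw [f.charpoly_natDegree, hV]; exact hdeg))
  have hX : (X ^ K - 1 : F[X]) = minpoly F f :=
    (eq_of_monic_of_dvd_of_natDegree_le hmonic (monic_X_pow_sub_C 1 hK)
      (minpoly.dvd F f (by simp [hf])) (by rw [← C_1, natDegree_X_pow_sub_C]; exact hdeg))
  rw [hchar, hX]

section CharacterCoinduction

variable {Γ k : Type*} [Group Γ] [Field k] {H : Subgroup Γ} (χ : H →* kˣ)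

/-- A character of `H` as a one-dimensional representation. -/
def characterRepresentation : Representation k H k :=
  (Algebra.lmul k k).toMonoidHom.comp ((Units.coeHom k).comp χ)

theorem characterRepresentation_apply (h : H) (a : k) :
    characterRepresentation χ h a = χ h * a := rfl

open Classical in
/-- The element of the representation coinduced from `χ` that extends `χ` by zero outside `H`. -/
noncomputable def coindVector :
    Representation.coindV H.subtype (characterRepresentation χ) :=
  ⟨fun g => if hg : g ∈ H then χ ⟨g, hg⟩ else 0, fun h g => by
    by_cases hg : g ∈ H
    · have hhg : (h : Γ) * g ∈ H := H.mul_mem h.2 hg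
      have hmul : (⟨h * g, hhg⟩ : H) = h * ⟨g, hg⟩ := rfl
      simp [characterRepresentation_apply, hg, hmul, H.mul_mem_cancel_left h.2]
    · simp [characterRepresentation_apply, hg, H.mul_mem_cancel_left h.2]⟩

theorem coindVector_coe (h : H) : (coindVector χ).1 h = χ h := by
  simp [coindVector]

theorem coindVector_of_notMem {g : Γ} (hg : g ∉ H) : (coindVector χ).1 g = 0 := by
  simp [coindVector, hg]

theorem coindVector_ne_zero : coindVector χ ≠ 0 := fun h0 => by
  have h1 := coindVector_coe χ 1
  simp [h0] at h1

theorem coind_coindVector (h : H) :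
    Representation.coind H.subtype (characterRepresentation χ) (h : Γ) (coindVector χ) =
      (χ h : k) • coindVector χ := by
  apply Subtype.ext
  funext g
  change (coindVector χ).1 (g * h) = χ h * (coindVector χ).1 g
  by_cases hg : g ∈ H
  · have h1 := coindVector_coe χ ⟨g, hg⟩
    have h2 := coindVector_coe χ (⟨g, hg⟩ * h)
    simp only [Subgroup.coe_mul, map_mul, Units.val_mul] at h1 h2
    rw [h1, h2, mul_comm]
  · rw [coindVector_of_notMem χ hg,
      coindVector_of_notMem χ (by rwa [H.mul_mem_cancel_right h.2]), mul_zero]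

variable {K : ℕ} {x : Γ}

/-- An element of the coinduced representation is determined by its values at inverses of left
coset representatives of `H`. -/
theorem coindV_evaluation_injective {ι : Type*} {t : ι → Γ} (ht : ∀ g : Γ, ∃ i, (t i)⁻¹ * g ∈ H)
    (σ : Representation k H k) :
    Function.Injective ((LinearMap.funLeft k k fun i => (t i)⁻¹).comp
      (Representation.coindV H.subtype σ).subtype) := by
  refine (injective_iff_map_eq_zero _).2 fun f hf => Subtype.ext (funext fun g => ?_)
  obtain ⟨i, hi⟩ := ht g⁻¹
  have hi' : g * t i ∈ H := by simpa using H.inv_mem hi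
  have h1 := f.2 ⟨g * t i, hi'⟩ (t i)⁻¹
  have h2 : f.1 (t i)⁻¹ = 0 := congrFun hf i
  simpa [h2] using h1

theorem linearIndependent_coind_pow_coindVector
    (hx : ∀ g : Γ, ∃! i : Fin K, (x ^ (i : ℕ))⁻¹ * g ∈ H) :
    LinearIndependent k fun i : Fin K =>
      (Representation.coind H.subtype (characterRepresentation χ) x ^ (i : ℕ))
        (coindVector χ) := by
  refine Fintype.linearIndependent_iff.2 fun c hc j => ?_
  have h := congrFun (congrArg Subtype.val hc) (x ^ (j : ℕ))⁻¹
  have hval (i : Fin K) :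
      ((Representation.coind H.subtype (characterRepresentation χ) x ^ (i : ℕ))
        (coindVector χ)).1 (x ^ (j : ℕ))⁻¹ = if i = j then 1 else 0 := by
    rw [← map_pow]
    change (coindVector χ).1 ((x ^ (j : ℕ))⁻¹ * x ^ (i : ℕ)) = _
    split_ifs with hij
    · subst hij
      simpa using coindVector_coe χ 1
    · exact coindVector_of_notMem χ fun hmem =>
        hij ((hx (x ^ (i : ℕ))).unique (by simp [H.one_mem]) hmem)
  simpa [-Representation.coind_apply, Finset.sum_apply, hval] using h

theorem finiteDimensional_coindV
    (hx : ∀ g : Γ, ∃! i : Fin K, (x ^ (i : ℕ))⁻¹ * g ∈ H)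
    (σ : Representation k H k) :
    FiniteDimensional k (Representation.coindV H.subtype σ) :=
  FiniteDimensional.of_injective _ (coindV_evaluation_injective (fun g => (hx g).exists) σ)

theorem finrank_coindV (hx : ∀ g : Γ, ∃! i : Fin K, (x ^ (i : ℕ))⁻¹ * g ∈ H) :
    Module.finrank k (Representation.coindV H.subtype (characterRepresentation χ)) = K := by
  have := finiteDimensional_coindV hx (characterRepresentation χ)
  apply le_antisymm
  · simpa using LinearMap.finrank_le_finrank_of_injective
      (coindV_evaluation_injective (fun g => (hx g).exists) (characterRepresentation χ))
  · simpa using (linearIndependent_coind_pow_coindVector χ hx).fintype_card_le_finrank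

open Polynomial in
theorem charpoly_coind_eq_X_pow_sub_one
    [FiniteDimensional k (Representation.coindV H.subtype (characterRepresentation χ))]
    (hx : ∀ g : Γ, ∃! i : Fin K, (x ^ (i : ℕ))⁻¹ * g ∈ H)
    (hK : K ≠ 0) (hxK : x ^ K = 1) :
    (Representation.coind H.subtype (characterRepresentation χ) x).charpoly = X ^ K - 1 :=
  LinearMap.charpoly_eq_X_pow_sub_one hK (finrank_coindV χ hx) _
    (by rw [← map_pow, hxK, map_one]) _ (linearIndependent_coind_pow_coindVector χ hx)

end CharacterCoinduction

/-- Induced representations are quasi-flat: if `x, y ∈ Γ` satisfy `x^K = y^K = 1`, and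
the powers `1, x, …, x^{K-1}` (resp. `1, y, …, y^{K-1}`) form a complete set of
representatives of the left cosets of a subgroup `H ≤ Γ`, then for any character
`χ : H →* ℂˣ` there is a `K`-dimensional representation of `Γ` in which `x` and `y`
both have characteristic polynomial `X^K - 1`, containing a nonzero `χ`-eigenvector
for `H`. -/
theorem stmt12 {Γ : Type*} [Group Γ] (K : ℕ) (hK : 1 ≤ K) (x y : Γ)
    (hx : x ^ K = 1) (hy : y ^ K = 1) (H : Subgroup Γ)
    (hxrep : ∀ g : Γ, ∃! i : Fin K, (x ^ (i : ℕ))⁻¹ * g ∈ H)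
    (hyrep : ∀ g : Γ, ∃! i : Fin K, (y ^ (i : ℕ))⁻¹ * g ∈ H)
    (χ : H →* ℂˣ) :
    ∃ ρ : Γ →* Matrix.GeneralLinearGroup (Fin K) ℂ,
      Matrix.charpoly ((ρ x : Matrix (Fin K) (Fin K) ℂ)) = Polynomial.X ^ K - 1 ∧
      Matrix.charpoly ((ρ y : Matrix (Fin K) (Fin K) ℂ)) = Polynomial.X ^ K - 1 ∧
      ∃ v : Fin K → ℂ, v ≠ 0 ∧
        ∀ h : H, (ρ (h : Γ) : Matrix (Fin K) (Fin K) ℂ).mulVec v = (χ h : ℂ) • v := by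
  have hfin := finiteDimensional_coindV hxrep (characterRepresentation χ)
  have hK0 : K ≠ 0 := Nat.one_le_iff_ne_zero.1 hK
  let b := Module.finBasisOfFinrankEq ℂ _ (finrank_coindV χ hxrep)
  let τ := Representation.coind H.subtype (characterRepresentation χ)
  let ρ : Γ →* Matrix.GeneralLinearGroup (Fin K) ℂ := MonoidHom.toHomUnits
    (((LinearMap.toMatrixAlgEquiv b : _ →* Matrix (Fin K) (Fin K) ℂ)).comp τ)
  have hρ (g : Γ) : (ρ g : Matrix (Fin K) (Fin K) ℂ) = LinearMap.toMatrix b b (τ g) := rfl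
  refine ⟨ρ, ?_, ?_, b.repr (coindVector χ), ?_, fun h => ?_⟩
  · rw [hρ, LinearMap.charpoly_toMatrix]
    exact charpoly_coind_eq_X_pow_sub_one χ hxrep hK0 hx
  · rw [hρ, LinearMap.charpoly_toMatrix]
    exact charpoly_coind_eq_X_pow_sub_one χ hyrep hK0 hy
  · intro h0
    exact coindVector_ne_zero χ (b.repr.map_eq_zero_iff.1 (DFunLike.coe_injective h0))
  · rw [hρ, LinearMap.toMatrix_mulVec_repr, coind_coindVector, map_smul, Finsupp.coe_smul]
end

section
/- Let R be a (not necessarily commutative) ring, n a natural number, and u : Fin n → Fin n → R a family of elements such that: u i j * u i k = − u i k * u i j whenever j ≠ k (anticommutation on rows); u i j * u k j = − u k j * u i j whenever i ≠ k (anticommutation on columns); and u i j * u k l = u k l * u i j whenever i ≠ k and j ≠ l. Let p be a natural number, I, J : Fin p → Fin n, and let z = ∏_{s=0}^{p−1} u (I s) (J s) be the ordered product. Then for all i, j: z * u i j = (−1)^E * (u i j * z), where E = card{s : I s = i ∧ J s ≠ j} + card{s : I s ≠ i ∧ J s = j}; moreover E has the same parity as R_i + C_j, where R_i = card{s : I s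 = i} and C_j = card{s : J s = j}. Consequently, if there is ε ∈ ℕ such that R_i ≡ ε (mod 2) for every i and C_j ≡ ε (mod 2) for every j (i.e., the exponent matrix of the word is bistochastic mod 2), then z commutes with u i j for all i, j. -/
/-- The ordered product `z = u_{I(0) J(0)} ⋯ u_{I(p-1) J(p-1)}`. -/
def wordProd {R : Type*} [Ring R] {n p : ℕ} (u : Fin n → Fin n → R)
    (I J : Fin p → Fin n) : R :=
  (List.ofFn fun s : Fin p => u (I s) (J s)).prod

/-- `E = #{s : I s = i, J s ≠ j} + #{s : I s ≠ i, J s = j}`. -/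
def Ecount {n p : ℕ} (I J : Fin p → Fin n) (i j : Fin n) : ℕ :=
  (Finset.univ.filter fun s : Fin p => I s = i ∧ J s ≠ j).card +
  (Finset.univ.filter fun s : Fin p => I s ≠ i ∧ J s = j).card

/-- The row count `R_i = #{s : I s = i}` (and, applied to `J`, the column count). -/
def Rcount {n p : ℕ} (I : Fin p → Fin n) (i : Fin n) : ℕ :=
  (Finset.univ.filter fun s : Fin p => I s = i).card

theorem Ecount_succ {n p : ℕ} (I J : Fin (p + 1) → Fin n) (i j : Fin n) :
    Ecount I J i j =
      ((if I 0 = i ∧ J 0 ≠ j then 1 else 0) + (if I 0 ≠ i ∧ J 0 = j then 1 else 0)) +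
        Ecount (fun s => I s.succ) (fun s => J s.succ) i j := by
  simp only [Ecount, Finset.card_filter, Fin.sum_univ_succ]
  ring

theorem wordProd_succ {R : Type*} [Ring R] {n p : ℕ} (u : Fin n → Fin n → R)
    (I J : Fin (p + 1) → Fin n) :
    wordProd u I J =
      u (I 0) (J 0) * wordProd u (fun s => I s.succ) (fun s => J s.succ) := by
  simp [wordProd, List.ofFn_succ]

theorem Ecount_mod_two {n p : ℕ} (I J : Fin p → Fin n) (i j : Fin n) :
    Ecount I J i j % 2 = (Rcount I i + Rcount J j) % 2 := by
  have h : Rcount I i + Rcount J j =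
      Ecount I J i j + 2 * (Finset.univ.filter fun s : Fin p => I s = i ∧ J s = j).card := by
    simp only [Ecount, Rcount, Finset.card_filter, Finset.mul_sum, ← Finset.sum_add_distrib]
    refine Finset.sum_congr rfl fun s _ => ?_
    by_cases h₁ : I s = i <;> by_cases h₂ : J s = j <;> simp [h₁, h₂]
  omega

theorem mul_generator_eq {R : Type*} [Ring R] {n : ℕ} (u : Fin n → Fin n → R)
    (hrow : ∀ i j k, j ≠ k → u i j * u i k = -(u i k * u i j))
    (hcol : ∀ i k j, i ≠ k → u i j * u k j = -(u k j * u i j))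
    (hcomm : ∀ i j k l, i ≠ k → j ≠ l → u i j * u k l = u k l * u i j)
    (k l i j : Fin n) :
    u k l * u i j =
      (-1 : R) ^ ((if k = i ∧ l ≠ j then 1 else 0) + (if k ≠ i ∧ l = j then 1 else 0)) *
        (u i j * u k l) := by
  by_cases h₁ : k = i
  · subst h₁
    by_cases h₂ : l = j
    · simp [h₂]
    · simp [h₂, hrow k l j h₂]
  · by_cases h₂ : l = j
    · subst h₂
      simp [h₁, hcol k i l h₁]
    · simp [h₁, h₂, hcomm k l i j h₁ h₂]

theorem wordProd_mul_generator {R : Type*} [Ring R] {n : ℕ} (u : Fin n → Fin n → R)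
    (hrow : ∀ i j k, j ≠ k → u i j * u i k = -(u i k * u i j))
    (hcol : ∀ i k j, i ≠ k → u i j * u k j = -(u k j * u i j))
    (hcomm : ∀ i j k l, i ≠ k → j ≠ l → u i j * u k l = u k l * u i j)
    {p : ℕ} (I J : Fin p → Fin n) (i j : Fin n) :
    wordProd u I J * u i j =
      (-1 : R) ^ Ecount I J i j * (u i j * wordProd u I J) := by
  induction p with
  | zero => simp [wordProd, Ecount]
  | succ p ih =>
    have hsign (m : ℕ) (a : R) : a * (-1) ^ m = (-1) ^ m * a :=
      (((Commute.one_right a).neg_right).pow_right m).eq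
    rw [wordProd_succ, Ecount_succ, mul_assoc, ih, ← mul_assoc, hsign, mul_assoc,
      ← mul_assoc (u (I 0) (J 0)), mul_generator_eq u hrow hcol hcomm, add_comm _ (Ecount _ _ _ _),
      pow_add _ (Ecount _ _ _ _)]
    simp only [mul_assoc]

/-- For a family `u : Fin n → Fin n → R` satisfying the `O_n^{-1}` relations
(anticommutation of distinct entries on each row and column, commutation otherwise),
the ordered product `z` of the `u_{I(s) J(s)}` satisfies
`z·u_{ij} = (-1)^E·(u_{ij}·z)` with `E ≡ R_i + C_j (mod 2)`; in particular if the
exponent matrix is bistochastic mod `2` then `z` is central among the generators. -/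
theorem stmt18 {R : Type*} [Ring R] {n : ℕ} (u : Fin n → Fin n → R)
    (hrow : ∀ i j k, j ≠ k → u i j * u i k = -(u i k * u i j))
    (hcol : ∀ i k j, i ≠ k → u i j * u k j = -(u k j * u i j))
    (hcomm : ∀ i j k l, i ≠ k → j ≠ l → u i j * u k l = u k l * u i j)
    {p : ℕ} (I J : Fin p → Fin n) (i j : Fin n) :
    wordProd u I J * u i j =
      (-1 : R) ^ Ecount I J i j * (u i j * wordProd u I J) ∧
    Ecount I J i j % 2 = (Rcount I i + Rcount J j) % 2 ∧
    (∀ ε : ℕ, (∀ i' : Fin n, Rcount I i' % 2 = ε % 2) →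
      (∀ j' : Fin n, Rcount J j' % 2 = ε % 2) →
      Commute (wordProd u I J) (u i j)) := by
  have hz := wordProd_mul_generator u hrow hcol hcomm I J i j
  have hE := Ecount_mod_two I J i j
  refine ⟨hz, hE, fun ε hI hJ => ?_⟩
  have hi := hI i
  have hj := hJ j
  have heven : Even (Ecount I J i j) := Nat.even_iff.mpr (by omega)
  rwa [heven.neg_one_pow, one_mul] at hz
end
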